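/- arXiv:2402.07874 — 8 statements merged into one kernel-verified Lean document; each statement's English description precedes it below -/
import Mathlib

section
/- Let w be a word over the alphabet {t_1,…,t_{N−1}, u_1,…,u_{N−1}} that is minimal, i.e. every word with the same image in the Brauer monoid B_N has length at least |w|. Then the word τ(w), obtained from w by replacing every letter u_i by t_i, is also minimal: every word with the same image in B_N as τ(w) has length at least |τ(w)| = |w|. -/
/-- Generators of the Brauer monoid `B_N`: the `T`-primes `t i` and `U`-primes `u i`
for `i` ranging over the `N - 1` possible indices. -/
inductive BrauerLetter (N : ℕ) where
  | t : Fin (N - 1) → BrauerLetter N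
  | u : Fin (N - 1) → BrauerLetter N

/-- `|i - j| = 1` on indices. -/
def BrauerAdj {N : ℕ} (i j : Fin (N - 1)) : Prop :=
  (i : ℕ) + 1 = (j : ℕ) ∨ (j : ℕ) + 1 = (i : ℕ)

/-- `|i - j| > 1` on indices. -/
def BrauerFar {N : ℕ} (i j : Fin (N - 1)) : Prop :=
  (i : ℕ) + 1 < (j : ℕ) ∨ (j : ℕ) + 1 < (i : ℕ)

/-- The generator `t i` as a word. -/
def Tgen {N : ℕ} (i : Fin (N - 1)) : FreeMonoid (BrauerLetter N) :=
  FreeMonoid.of (BrauerLetter.t i)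

/-- The generator `u i` as a word. -/
def Ugen {N : ℕ} (i : Fin (N - 1)) : FreeMonoid (BrauerLetter N) :=
  FreeMonoid.of (BrauerLetter.u i)

/-- The ten "delete" relations, oriented from the longer to the shorter side. -/
inductive DeleteRule (N : ℕ) : FreeMonoid (BrauerLetter N) → FreeMonoid (BrauerLetter N) → Prop where
  | tt (i : Fin (N - 1)) : DeleteRule N (Tgen i * Tgen i) 1
  | uu (i : Fin (N - 1)) : DeleteRule N (Ugen i * Ugen i) (Ugen i)
  | tu (i : Fin (N - 1)) : DeleteRule N (Tgen i * Ugen i) (Ugen i)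
  | ut (i : Fin (N - 1)) : DeleteRule N (Ugen i * Tgen i) (Ugen i)
  | uuu (i j : Fin (N - 1)) (h : BrauerAdj i j) :
      DeleteRule N (Ugen i * Ugen j * Ugen i) (Ugen i)
  | utu (i j : Fin (N - 1)) (h : BrauerAdj i j) :
      DeleteRule N (Ugen i * Tgen j * Ugen i) (Ugen i)
  | tuu (i j : Fin (N - 1)) (h : BrauerAdj i j) :
      DeleteRule N (Tgen i * Ugen j * Ugen i) (Tgen j * Ugen i)
  | uut (i j : Fin (N - 1)) (h : BrauerAdj i j) :
      DeleteRule N (Ugen i * Ugen j * Tgen i) (Ugen i * Tgen j)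
  | utt (i j : Fin (N - 1)) (h : BrauerAdj i j) :
      DeleteRule N (Ugen i * Tgen j * Tgen i) (Ugen i * Ugen j)
  | ttu (i j : Fin (N - 1)) (h : BrauerAdj i j) :
      DeleteRule N (Tgen i * Tgen j * Ugen i) (Ugen j * Ugen i)

/-- The two "braid" relations. -/
inductive BraidRule (N : ℕ) : FreeMonoid (BrauerLetter N) → FreeMonoid (BrauerLetter N) → Prop where
  | ttt (i j : Fin (N - 1)) (h : BrauerAdj i j) :
      BraidRule N (Tgen i * Tgen j * Tgen i) (Tgen j * Tgen i * Tgen j)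
  | tut (i j : Fin (N - 1)) (h : BrauerAdj i j) :
      BraidRule N (Tgen i * Ugen j * Tgen i) (Tgen j * Ugen i * Tgen j)

/-- The four "swap" relations. -/
inductive SwapRule (N : ℕ) : FreeMonoid (BrauerLetter N) → FreeMonoid (BrauerLetter N) → Prop where
  | tt (i j : Fin (N - 1)) (h : BrauerFar i j) : SwapRule N (Tgen i * Tgen j) (Tgen j * Tgen i)
  | tu (i j : Fin (N - 1)) (h : BrauerFar i j) : SwapRule N (Tgen i * Ugen j) (Ugen j * Tgen i)
  | ut (i j : Fin (N - 1)) (h : BrauerFar i j) : SwapRule N (Ugen i * Tgen j) (Tgen j * Ugen i)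
  | uu (i j : Fin (N - 1)) (h : BrauerFar i j) : SwapRule N (Ugen i * Ugen j) (Ugen j * Ugen i)

/-- All defining relations of the Brauer monoid. -/
def brauerRel (N : ℕ) (x y : FreeMonoid (BrauerLetter N)) : Prop :=
  DeleteRule N x y ∨ BraidRule N x y ∨ SwapRule N x y

/-- The congruence on words generated by the Brauer relations; two words have the same
image in the Brauer monoid `B_N` iff they are related by `brauerCon N`. -/
def brauerCon (N : ℕ) : Con (FreeMonoid (BrauerLetter N)) :=
  conGen (brauerRel N)

/-- The map `τ` replacing every letter `u i` by `t i`. -/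
def tauLetter {N : ℕ} : BrauerLetter N → BrauerLetter N
  | BrauerLetter.t i => BrauerLetter.t i
  | BrauerLetter.u i => BrauerLetter.t i

/-- `τ` applied to a word, letter by letter. -/
def tauWord {N : ℕ} : FreeMonoid (BrauerLetter N) → FreeMonoid (BrauerLetter N) :=
  FreeMonoid.map tauLetter


namespace BrauerTau

variable {N : ℕ}

/-- Index of a letter. -/
def idx : BrauerLetter N → ℕ
  | BrauerLetter.t i => i
  | BrauerLetter.u i => i

/-- Underlying permutation of a word. -/
def P (l : List (BrauerLetter N)) : Equiv.Perm ℕ :=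
  (l.map (fun a => Equiv.swap (idx a) (idx a + 1))).prod

lemma P_append (x y : List (BrauerLetter N)) : P (x ++ y) = P x * P y := by
  simp [P]

/-- Same image in the Brauer monoid. -/
def C (x y : List (BrauerLetter N)) : Prop :=
  brauerCon N (FreeMonoid.ofList x) (FreeMonoid.ofList y)

lemma C_ctx {x y : List (BrauerLetter N)} (h : C x y) (p q : List (BrauerLetter N)) :
    C (p ++ x ++ q) (p ++ y ++ q) :=
  (brauerCon N).mul ((brauerCon N).mul ((brauerCon N).refl _) h) ((brauerCon N).refl _)

lemma C_of {x y : List (BrauerLetter N)}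
    (h : brauerRel N (FreeMonoid.ofList x) (FreeMonoid.ofList y)) : C x y :=
  ConGen.Rel.of _ _ h

/-- Minimal words. -/
def Mn (x : List (BrauerLetter N)) : Prop := ∀ v, C x v → x.length ≤ v.length

/-- Equivalence keeping the length and the underlying permutation. -/
def E (x y : List (BrauerLetter N)) : Prop := C x y ∧ x.length = y.length ∧ P x = P y

lemma E_refl (x : List (BrauerLetter N)) : E x x := ⟨(brauerCon N).refl _, rfl, rfl⟩

lemma E_trans {x y z : List (BrauerLetter N)} (h : E x y) (k : E y z) : E x z :=
  ⟨(brauerCon N).trans h.1 k.1, h.2.1.trans k.2.1, h.2.2.trans k.2.2⟩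

lemma E_ctx {x y : List (BrauerLetter N)} (h : E x y) (p q : List (BrauerLetter N)) :
    E (p ++ x ++ q) (p ++ y ++ q) :=
  ⟨C_ctx h.1 p q, by simp [h.2.1], by simp [P_append, h.2.2]⟩

lemma Mn_E {x y : List (BrauerLetter N)} (h : E x y) (m : Mn x) : Mn y := fun v hv => by
  rw [← h.2.1]; exact m v ((brauerCon N).trans h.1 hv)

lemma Mn_ctx {x p q : List (BrauerLetter N)} (m : Mn (p ++ x ++ q)) : Mn x := fun v hv => by
  have := m _ (C_ctx hv p q)
  simp at this; omega

lemma swap_far {i j : ℕ} (h : i + 1 < j ∨ j + 1 < i) :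
    Equiv.swap i (i+1) * Equiv.swap j (j+1) = Equiv.swap j (j+1) * Equiv.swap i (i+1) := by
  ext x
  simp only [Equiv.Perm.mul_apply, Equiv.swap_apply_def]
  split_ifs <;> omega

lemma swap_braid_aux (i : ℕ) :
    Equiv.swap i (i+1) * (Equiv.swap (i+1) (i+1+1) * Equiv.swap i (i+1))
      = Equiv.swap (i+1) (i+1+1) * (Equiv.swap i (i+1) * Equiv.swap (i+1) (i+1+1)) := by
  have h1 := Equiv.swap_mul_swap_mul_swap (x := i + 1 + 1) (y := i + 1) (z := i)
    (by omega) (by omega)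
  have h2 := Equiv.swap_mul_swap_mul_swap (x := i) (y := i + 1) (z := i + 1 + 1)
    (by omega) (by omega)
  rw [Equiv.swap_comm (i+1) i, Equiv.swap_comm (i+1+1) (i+1)] at h1
  rw [← mul_assoc, ← mul_assoc, h1, h2, Equiv.swap_comm]

lemma swap_braid {i j : ℕ} (h : i + 1 = j ∨ j + 1 = i) :
    Equiv.swap i (i+1) * (Equiv.swap j (j+1) * Equiv.swap i (i+1))
      = Equiv.swap j (j+1) * (Equiv.swap i (i+1) * Equiv.swap j (j+1)) := by
  rcases h with rfl | rfl
  · exact swap_braid_aux i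
  · exact (swap_braid_aux j).symm

lemma E_far (a b : BrauerLetter N) (h : idx a + 1 < idx b ∨ idx b + 1 < idx a) :
    E [a, b] [b, a] := by
  refine ⟨C_of (Or.inr (Or.inr ?_)), rfl, ?_⟩
  · cases a <;> cases b
    · exact SwapRule.tt _ _ h
    · exact SwapRule.tu _ _ h
    · exact SwapRule.ut _ _ h
    · exact SwapRule.uu _ _ h
  · simpa [P] using swap_far h

lemma not_Mn_same (a b : BrauerLetter N) (h : idx a = idx b) : ¬ Mn [a, b] := by
  intro m
  cases a <;> cases b <;> (obtain rfl := Fin.ext h)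
  · simpa using m [] (C_of (Or.inl (DeleteRule.tt _)))
  · simpa using m [.u _] (C_of (Or.inl (DeleteRule.tu _)))
  · simpa using m [.u _] (C_of (Or.inl (DeleteRule.ut _)))
  · simpa using m [.u _] (C_of (Or.inl (DeleteRule.uu _)))

lemma E_braid (a b c : BrauerLetter N) (hac : idx a = idx c)
    (h : idx a + 1 = idx b ∨ idx b + 1 = idx a) (m : Mn [a, b, c]) :
    ∃ x y z : BrauerLetter N, idx x = idx b ∧ idx y = idx a ∧ idx z = idx b ∧
      E [a, b, c] [x, y, z] := by
  cases a with
  | t i =>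
    cases b with
    | t j =>
      cases c with
      | t k =>
        obtain rfl := Fin.ext hac
        exact ⟨.t j, .t i, .t j, rfl, rfl, rfl, C_of (Or.inr (Or.inl (BraidRule.ttt i j h))), rfl,
          by simpa [P, idx] using swap_braid h⟩
      | u k =>
        obtain rfl := Fin.ext hac
        simpa using m [.u j, .u i] (C_of (Or.inl (DeleteRule.ttu i j h)))
    | u j =>
      cases c with
      | t k =>
        obtain rfl := Fin.ext hac
        exact ⟨.t j, .u i, .t j, rfl, rfl, rfl, C_of (Or.inr (Or.inl (BraidRule.tut i j h))), rfl,
          by simpa [P, idx] using swap_braid h⟩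
      | u k =>
        obtain rfl := Fin.ext hac
        simpa using m [.t j, .u i] (C_of (Or.inl (DeleteRule.tuu i j h)))
  | u i =>
    cases b with
    | t j =>
      cases c with
      | t k =>
        obtain rfl := Fin.ext hac
        simpa using m [.u i, .u j] (C_of (Or.inl (DeleteRule.utt i j h)))
      | u k =>
        obtain rfl := Fin.ext hac
        simpa using m [.u i] (C_of (Or.inl (DeleteRule.utu i j h)))
    | u j =>
      cases c with
      | t k =>
        obtain rfl := Fin.ext hac
        simpa using m [.u i, .t j] (C_of (Or.inl (DeleteRule.uut i j h)))
      | u k =>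
        obtain rfl := Fin.ext hac
        simpa using m [.u i] (C_of (Or.inl (DeleteRule.uuu i j h)))

/-- Descending runs of letters with indices `n, n-1, …, k`. -/
inductive Run (n : ℕ) : ℕ → List (BrauerLetter N) → Prop
  | nil : Run n (n + 1) []
  | snoc {k : ℕ} {r : List (BrauerLetter N)} {a : BrauerLetter N} :
      Run n (k + 1) r → idx a = k → Run n k (r ++ [a])

/-- Normal forms. -/
inductive NF : ℕ → List (BrauerLetter N) → Prop
  | nil : NF 0 []
  | step {n k : ℕ} {y r : List (BrauerLetter N)} : NF n y → Run n k r → NF (n + 1) (y ++ r)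

lemma Run_comm {n k : ℕ} {r : List (BrauerLetter N)} (h : Run n k r) (a : BrauerLetter N)
    (ha : idx a + 1 < k) : E (r ++ [a]) ([a] ++ r) := by
  induction h with
  | nil => exact E_refl _
  | @snoc k r c hr hc ih =>
    have h1 := E_ctx (E_far c a (Or.inr (by omega))) r []
    have h2 := E_ctx (ih (by omega)) [] [c]
    refine E_trans (y := r ++ [a] ++ [c]) ?_ ?_
    · simpa using h1
    · simpa using h2

lemma Run_le {n k : ℕ} {r : List (BrauerLetter N)} (h : Run n k r) : k ≤ n + 1 := by
  induction h with
  | nil => exact le_rfl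
  | snoc _ _ ih => omega

lemma Run_inv {n k : ℕ} {r : List (BrauerLetter N)} (h : Run n k r) (hk : k ≤ n) :
    ∃ r2 a, r = r2 ++ [a] ∧ Run n (k + 1) r2 ∧ idx a = k := by
  cases h with
  | nil => omega
  | snoc h1 h2 => exact ⟨_, _, rfl, h1, h2⟩

lemma Run_pass {n k : ℕ} {r : List (BrauerLetter N)} (h : Run n k r) (a : BrauerLetter N) (j : ℕ)
    (ha : idx a = j + 1) (hkj : k ≤ j) (hj : j + 1 ≤ n) (m : Mn (r ++ [a])) :
    ∃ b r2, idx b = j ∧ Run n k r2 ∧ E (r ++ [a]) ([b] ++ r2) := by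
  induction h with
  | nil => omega
  | @snoc k r c hr hc ih =>
    rcases hkj.lt_or_eq with hlt | rfl
    · have h1 : E (r ++ [c] ++ [a]) (r ++ [a] ++ [c]) := by
        simpa using E_ctx (E_far c a (Or.inl (by omega))) r []
      have m1 := Mn_E h1 m
      have m2 : Mn (r ++ [a]) := Mn_ctx (p := []) (q := [c]) (by simpa using m1)
      obtain ⟨b, r2, hb, hr2, he⟩ := ih (by omega) m2
      refine ⟨b, r2 ++ [c], hb, Run.snoc hr2 hc, E_trans h1 ?_⟩
      simpa using E_ctx he [] [c]
    · obtain ⟨r1, d, rfl, hr1, hd⟩ := Run_inv hr hj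
      have m1 : Mn [d, c, a] := Mn_ctx (p := r1) (q := []) (by simpa using m)
      obtain ⟨x, y, z, hx, hy, hz, he⟩ := E_braid d c a (by omega) (by omega) m1
      refine ⟨x, r1 ++ [y] ++ [z], by omega,
        Run.snoc (Run.snoc hr1 (by omega)) (by omega), ?_⟩
      refine E_trans (y := r1 ++ [x] ++ [y, z]) ?_ ?_
      · simpa using E_ctx he r1 []
      · simpa using E_ctx (Run_comm hr1 x (by omega)) [] [y, z]

lemma NF_step {n : ℕ} {y : List (BrauerLetter N)} (h : NF n y) (a : BrauerLetter N)
    (ha : idx a < n) (m : Mn (y ++ [a])) : ∃ z, NF n z ∧ E (y ++ [a]) z := by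
  induction h generalizing a with
  | nil => omega
  | @step n k y r hy hr ih =>
    rcases lt_trichotomy (idx a + 1) k with hlt | heq | hgt
    · have h1 : E (y ++ r ++ [a]) (y ++ [a] ++ r) := by
        simpa using E_ctx (Run_comm hr a hlt) y []
      have m2 : Mn (y ++ [a]) := Mn_ctx (p := []) (q := r) (by simpa using Mn_E h1 m)
      have := Run_le hr
      obtain ⟨z, hz, he⟩ := ih a (by omega) m2
      exact ⟨z ++ r, NF.step hz hr, E_trans h1 (by simpa using E_ctx he [] r)⟩
    · subst heq
      refine ⟨y ++ (r ++ [a]), NF.step hy (Run.snoc hr rfl), ?_⟩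
      simpa using E_refl _
    · rcases (Nat.lt_succ_iff.mp hgt).lt_or_eq with hlt | heq
      · obtain ⟨j, hj⟩ : ∃ j, idx a = j + 1 := ⟨idx a - 1, by omega⟩
        obtain ⟨b, r2, hb, hr2, he⟩ := Run_pass hr a j hj (by omega) (by omega)
          (Mn_ctx (p := y) (q := []) (by simpa using m))
        have h1 : E (y ++ r ++ [a]) (y ++ [b] ++ r2) := by
          simpa using E_ctx he y []
        have m2 : Mn (y ++ [b]) := Mn_ctx (p := []) (q := r2) (by simpa using Mn_E h1 m)
        obtain ⟨z, hz, he⟩ := ih b (by omega) m2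
        exact ⟨z ++ r2, NF.step hz hr2, E_trans h1 (by simpa using E_ctx he [] r2)⟩
      · obtain ⟨r1, c, rfl, hr1, hc⟩ := Run_inv hr (by omega)
        exact absurd (Mn_ctx (x := [c, a]) (p := y ++ r1) (q := []) (by simpa using m))
          (not_Mn_same c a (by omega))

lemma NF_nil (n : ℕ) : NF n ([] : List (BrauerLetter N)) := by
  induction n with
  | zero => exact NF.nil
  | succ n ih => exact NF.step ih Run.nil

lemma exists_NF (w : List (BrauerLetter N)) (m : Mn w) : ∃ z, NF (N - 1) z ∧ E w z := by
  induction w using List.reverseRecOn with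
  | nil => exact ⟨[], NF_nil _, E_refl _⟩
  | append_singleton w a ih =>
    obtain ⟨z, hz, he⟩ := ih (Mn_ctx (p := []) (q := [a]) (by simpa using m))
    have h1 : E (w ++ [a]) (z ++ [a]) := by simpa using E_ctx he [] [a]
    obtain ⟨z2, hz2, heq2⟩ := NF_step hz a (by cases a <;> simp [idx]) (Mn_E h1 m)
    exact ⟨z2, hz2, E_trans h1 heq2⟩

/-- Inversions of a permutation among the positions `< M`. -/
def Inv (M : ℕ) (σ : Equiv.Perm ℕ) : Finset (ℕ × ℕ) :=
  (Finset.range M ×ˢ Finset.range M).filter (fun p => p.1 < p.2 ∧ σ p.2 < σ p.1)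

lemma mem_Inv (M : ℕ) (σ : Equiv.Perm ℕ) (a b : ℕ) :
    (a, b) ∈ Inv M σ ↔ (a < M ∧ b < M) ∧ a < b ∧ σ b < σ a := by
  simp [Inv]

lemma inv_up (M j : ℕ) (hj : j + 1 < M) (σ : Equiv.Perm ℕ) (h : σ j < σ (j+1)) :
    (Inv M (σ * Equiv.swap j (j+1))).card = (Inv M σ).card + 1 := by
  set s := Equiv.swap j (j+1) with hs
  have e : Inv M (σ * s) =
      insert (j, j+1) ((Inv M σ).map (s.prodCongr s).toEmbedding) := by
    ext ⟨a, b⟩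
    rw [Finset.mem_insert, Finset.mem_map_equiv]
    have hss : s.symm = s := Equiv.symm_swap _ _
    simp only [mem_Inv, Equiv.Perm.mul_apply,
      Equiv.prodCongr_symm, Equiv.prodCongr_apply, Prod.map, hss, Prod.mk.injEq]
    by_cases hab : a = j ∧ b = j + 1
    · obtain ⟨rfl, rfl⟩ := hab
      simp [hs, h]; omega
    · by_cases hba : b = j ∧ a = j + 1
      · obtain ⟨rfl, rfl⟩ := hba
        simp [hs]; omega
      · have key : (a < M ∧ b < M) ∧ a < b ↔ (s a < M ∧ s b < M) ∧ s a < s b := by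
          simp only [hs, Equiv.swap_apply_def]
          split_ifs <;> omega
        simp only [hab, false_or]
        tauto
  rw [e, Finset.card_insert_of_notMem, Finset.card_map]
  rw [Finset.mem_map_equiv]
  simp [Inv, hs]

lemma inv_le (M j : ℕ) (hj : j + 1 < M) (σ : Equiv.Perm ℕ) :
    (Inv M (σ * Equiv.swap j (j+1))).card ≤ (Inv M σ).card + 1 := by
  rcases lt_trichotomy (σ j) (σ (j+1)) with h | h | h
  · exact (inv_up M j hj σ h).le
  · have := σ.injective h; omega
  · have := inv_up M j hj (σ * Equiv.swap j (j+1)) (by simpa using h)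
    rw [mul_assoc, Equiv.swap_mul_self, mul_one] at this
    omega

lemma inv_P_le (v : List (BrauerLetter N)) : (Inv N (P v)).card ≤ v.length := by
  induction v using List.reverseRecOn with
  | nil =>
    simp only [P, Inv, List.map_nil, List.prod_nil, List.length_nil, Nat.le_zero,
      Finset.card_eq_zero, Finset.filter_eq_empty_iff]
    intro p _ h
    simp at h; omega
  | append_singleton v a ih =>
    rw [P_append]
    have := inv_le N (idx a) (by cases a <;> simp [idx] <;> omega) (P v)
    simp only [P, List.map_cons, List.map_nil, List.prod_cons, List.prod_nil, mul_one,
      List.length_append, List.length_singleton] at *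
    omega

lemma P_snoc (v : List (BrauerLetter N)) (a : BrauerLetter N) :
    P (v ++ [a]) = P v * Equiv.swap (idx a) (idx a + 1) := by
  rw [P_append]; simp [P]

lemma Run_card {n k : ℕ} {y r : List (BrauerLetter N)} (hr : Run n k r)
    (hy : ∀ x, n < x → P y x = x) (hc : (Inv N (P y)).card = y.length) :
    (∀ x, n + 1 < x → P (y ++ r) x = x) ∧ (P (y ++ r) k = n + 1) ∧
    (∀ x, x < k → P (y ++ r) x = P y x) ∧ (Inv N (P (y ++ r))).card = (y ++ r).length := by
  induction hr with
  | nil =>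
    simp only [List.append_nil]
    exact ⟨fun x hx => hy x (by omega), hy _ (by omega), by intros; trivial, hc⟩
  | @snoc k r a hr ha ih =>
    obtain ⟨h1, h2, h3, h4⟩ := ih
    have hle := Run_le hr
    rw [← List.append_assoc, P_snoc, ha]
    refine ⟨fun x hx => ?_, ?_, fun x hx => ?_, ?_⟩
    · rw [Equiv.Perm.mul_apply, Equiv.swap_apply_of_ne_of_ne (by omega) (by omega), h1 x hx]
    · simpa using h2
    · rw [Equiv.Perm.mul_apply, Equiv.swap_apply_of_ne_of_ne (by omega) (by omega),
        h3 x (by omega)]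
    · rw [inv_up N k, h4]
      · simp; omega
      · have : idx a + 1 < N := by cases a <;> simp [idx] <;> omega
        omega
      · rw [h2, h3 k (by omega)]
        by_contra hcon
        have h5 := hy (P y k) (by omega)
        have h6 := (P y).injective h5
        omega

lemma NF_card {n : ℕ} {y : List (BrauerLetter N)} (h : NF n y) :
    (∀ x, n < x → P y x = x) ∧ (Inv N (P y)).card = y.length := by
  induction h with
  | nil =>
    refine ⟨fun x _ => by simp [P], ?_⟩
    have := inv_P_le (N := N) []
    simpa using this
  | step _ hr ih =>
    have := Run_card hr ih.1 ih.2
    exact ⟨this.1, this.2.2.2⟩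

/-- The representation on permutations with zero. -/
def phiL : BrauerLetter N → WithZero (Equiv.Perm ℕ)
  | BrauerLetter.t i => ((Equiv.swap (i : ℕ) (i + 1) : Equiv.Perm ℕ) : WithZero (Equiv.Perm ℕ))
  | BrauerLetter.u _ => 0

/-- The representation on permutations with zero, on words. -/
def phi : FreeMonoid (BrauerLetter N) →* WithZero (Equiv.Perm ℕ) := FreeMonoid.lift phiL

lemma phi_con {x y : FreeMonoid (BrauerLetter N)} (h : brauerCon N x y) : phi x = phi y := by
  have : brauerCon N ≤ Con.ker (phi (N := N)) := by
    apply Con.conGen_le.mpr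
    intro x y h
    rw [Con.ker_rel]
    rcases h with h | h | h
    · cases h <;> simp [phi, Tgen, Ugen, phiL, ← WithZero.coe_mul]
    · cases h with
      | ttt i j h =>
        simp only [phi, Tgen, phiL, map_mul, FreeMonoid.lift_eval_of, ← WithZero.coe_mul, mul_assoc]
        rw [swap_braid h]
      | tut i j h => simp [phi, Tgen, Ugen, phiL]
    · cases h with
      | tt i j h =>
        simp only [phi, Tgen, phiL, map_mul, FreeMonoid.lift_eval_of, ← WithZero.coe_mul]
        rw [swap_far h]
      | tu i j h => simp [phi, Tgen, Ugen, phiL]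
      | ut i j h => simp [phi, Tgen, Ugen, phiL]
      | uu i j h => simp [phi, Tgen, Ugen, phiL]
  exact this h

lemma phi_cons (a : BrauerLetter N) (v : List (BrauerLetter N)) :
    phi (FreeMonoid.ofList (a :: v)) = phiL a * phi (FreeMonoid.ofList v) := by
  rw [FreeMonoid.ofList_cons, map_mul]; simp [phi]

lemma P_cons (a : BrauerLetter N) (v : List (BrauerLetter N)) :
    P (a :: v) = Equiv.swap (idx a) (idx a + 1) * P v := by simp [P]

lemma phi_cases (v : List (BrauerLetter N)) :
    phi (FreeMonoid.ofList v) = 0 ∨ phi (FreeMonoid.ofList v) = (P v : WithZero _) := by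
  induction v with
  | nil => right; rfl
  | cons a v ih =>
    rw [phi_cons, P_cons]
    rcases ih with h | h
    · left; rw [h, mul_zero]
    · rw [h]
      cases a
      · right; simp [phiL, idx]
      · left; simp [phiL]

lemma phi_tau (v : List (BrauerLetter N)) :
    phi (FreeMonoid.ofList (v.map tauLetter)) = (P v : WithZero _) := by
  induction v with
  | nil => rfl
  | cons a v ih =>
    rw [List.map_cons, phi_cons, P_cons, ih]
    cases a <;> simp [phiL, idx, tauLetter]

end BrauerTau

/-- If a word `w` is minimal (every word with the same image in `B_N` has length at least
`|w|`), then `τ(w)` is also minimal. -/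
theorem tau_of_minimal_is_minimal (N : ℕ) (w : FreeMonoid (BrauerLetter N))
    (hw : ∀ v : FreeMonoid (BrauerLetter N), brauerCon N w v → w.length ≤ v.length) :
    ∀ v : FreeMonoid (BrauerLetter N),
      brauerCon N (tauWord w) v → (tauWord w).length ≤ v.length := by
  intro v hv
  obtain ⟨z, hz, he⟩ := BrauerTau.exists_NF (FreeMonoid.toList w) (fun v h => hw v h)
  have h1 := (BrauerTau.NF_card hz).2
  rw [← he.2.2, ← he.2.1] at h1
  have h2 := BrauerTau.phi_con hv
  have h3 : BrauerTau.phi (tauWord w) = (BrauerTau.P (FreeMonoid.toList w) : WithZero _) :=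
    BrauerTau.phi_tau (FreeMonoid.toList w)
  have h4 : (tauWord w).length = (FreeMonoid.toList w).length :=
    List.length_map (as := FreeMonoid.toList w) tauLetter
  have h5 := BrauerTau.inv_P_le (FreeMonoid.toList v)
  rw [h3] at h2
  rcases BrauerTau.phi_cases (FreeMonoid.toList v) with h | h
  · rw [FreeMonoid.ofList_toList] at h
    rw [h] at h2
    exact absurd h2 WithZero.coe_ne_zero
  · rw [FreeMonoid.ofList_toList] at h
    rw [h] at h2
    have h6 := WithZero.coe_injective h2
    rw [h6] at h1
    rw [h4, ← h1]
    exact h5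
end

section
/- Assume that every word over {t_1,…,t_{N−1}, u_1,…,u_{N−1}} can be transformed into a minimal word with the same image in B_N by a finite sequence of one-step rewrites (delete, braid and swap rules applied in context). Then, if a word w = w₁ w₂ w₃ is minimal (every word with the same image in B_N has length at least |w|), the word w₁ τ(w₂) w₃, obtained by applying τ only to the subword w₂, is also minimal. -/
/-- A one-step rewrite: replace a subword `l` by `r` in context, where `l → r` is a
delete rule (oriented from longer to shorter side) or an instance of a braid or swap
rule used in either direction. -/
def BrauerStep (N : ℕ) (x y : FreeMonoid (BrauerLetter N)) : Prop :=
  ∃ p q l r : FreeMonoid (BrauerLetter N),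
    (DeleteRule N l r ∨ BraidRule N l r ∨ BraidRule N r l ∨
      SwapRule N l r ∨ SwapRule N r l) ∧
    x = p * l * q ∧ y = p * r * q

/-- `Dom x y`: the word `y` arises from `x` by replacing some letters `u i` by `t i`. -/
def Dom {N : ℕ} (x y : FreeMonoid (BrauerLetter N)) : Prop :=
  List.Forall₂ (fun a b => b = a ∨ b = tauLetter a) x.toList y.toList

theorem Dom.mul {N : ℕ} {x y x' y' : FreeMonoid (BrauerLetter N)}
    (h : Dom x y) (h' : Dom x' y') : Dom (x * x') (y * y') :=
  List.rel_append h h'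

theorem Dom.refl {N : ℕ} (x : FreeMonoid (BrauerLetter N)) : Dom x x :=
  List.forall₂_same.2 fun _ _ => Or.inl rfl

theorem Dom.tau {N : ℕ} (x : FreeMonoid (BrauerLetter N)) : Dom x (tauWord x) :=
  List.forall₂_map_right_iff.2 (List.forall₂_same.2 fun _ _ => Or.inr rfl)

theorem Dom.length_eq {N : ℕ} {x y : FreeMonoid (BrauerLetter N)} (h : Dom x y) :
    x.length = y.length :=
  List.Forall₂.length_eq h

theorem Dom.split {N : ℕ} {x a b : FreeMonoid (BrauerLetter N)} (h : Dom x (a * b)) :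
    ∃ x₁ x₂, x = x₁ * x₂ ∧ Dom x₁ a ∧ Dom x₂ b := by
  refine ⟨FreeMonoid.ofList (x.toList.take a.length), FreeMonoid.ofList (x.toList.drop a.length),
    (List.take_append_drop _ _).symm, ?_, ?_⟩
  · have := List.forall₂_take a.length h
    rwa [FreeMonoid.toList_mul, show a.length = a.toList.length from rfl,
      List.take_left] at this
  · have := List.forall₂_drop a.length h
    rwa [FreeMonoid.toList_mul, show a.length = a.toList.length from rfl,
      List.drop_left] at this

theorem Dom.t_inv {N : ℕ} {x : FreeMonoid (BrauerLetter N)} {i : Fin (N - 1)}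
    (h : Dom x (Tgen i)) : x = Tgen i ∨ x = Ugen i := by
  rcases x with _ | ⟨a, _ | ⟨b, l⟩⟩
  · cases h
  · rcases h with _ | ⟨h, _⟩
    rcases a with j | j <;> simp only [tauLetter] at h
    · left; simp at h; subst h; rfl
    · right; simp at h; subst h; rfl
  · rcases h with _ | ⟨_, ⟨⟩⟩

theorem Dom.u_inv {N : ℕ} {x : FreeMonoid (BrauerLetter N)} {i : Fin (N - 1)}
    (h : Dom x (Ugen i)) : x = Ugen i := by
  rcases x with _ | ⟨a, _ | ⟨b, l⟩⟩
  · cases h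
  · rcases h with _ | ⟨h, _⟩
    rcases a with j | j <;> simp only [tauLetter] at h
    · simp at h
    · simp at h; subst h; rfl
  · rcases h with _ | ⟨_, ⟨⟩⟩

theorem Dom.tu {N : ℕ} (i : Fin (N - 1)) : Dom (Ugen i) (Tgen i) := Dom.tau (Ugen i)

theorem BrauerAdj.symm' {N : ℕ} {i j : Fin (N - 1)} (h : BrauerAdj i j) : BrauerAdj j i :=
  Or.symm h

theorem DeleteRule.length_lt {N : ℕ} {l r : FreeMonoid (BrauerLetter N)}
    (h : DeleteRule N l r) : r.length < l.length := by
  cases h <;> simp [Tgen, Ugen]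

theorem dom_delete {N : ℕ} {l r l' : FreeMonoid (BrauerLetter N)}
    (h : DeleteRule N l r) (hd : Dom l' l) : ∃ r', DeleteRule N l' r' := by
  cases h with
  | tt i | uu i | tu i | ut i =>
    obtain ⟨a, b, rfl, ha, hb⟩ := hd.split
    first
    | (rcases ha.t_inv with (rfl | rfl))
    | obtain rfl := ha.u_inv
    all_goals
      first
      | (rcases hb.t_inv with (rfl | rfl))
      | obtain rfl := hb.u_inv
    all_goals exact ⟨_, by constructor⟩
  | uuu i j h | utu i j h | tuu i j h | uut i j h | utt i j h | ttu i j h =>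
    obtain ⟨ab, c, rfl, hab, hc⟩ := hd.split
    obtain ⟨a, b, rfl, ha, hb⟩ := hab.split
    first
    | (rcases ha.t_inv with (rfl | rfl))
    | obtain rfl := ha.u_inv
    all_goals
      first
      | (rcases hb.t_inv with (rfl | rfl))
      | obtain rfl := hb.u_inv
    all_goals
      first
      | (rcases hc.t_inv with (rfl | rfl))
      | obtain rfl := hc.u_inv
    all_goals
      with_reducible first
      | exact ⟨_, .uuu i j h⟩
      | exact ⟨_, .utu i j h⟩
      | exact ⟨_, .tuu i j h⟩
      | exact ⟨_, .uut i j h⟩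
      | exact ⟨_, .utt i j h⟩
      | exact ⟨_, .ttu i j h⟩

theorem dom_braid {N : ℕ} {l r l' : FreeMonoid (BrauerLetter N)}
    (h : BraidRule N l r) (hd : Dom l' l) :
    (∃ r', DeleteRule N l' r') ∨ ∃ r', BraidRule N l' r' ∧ Dom r' r := by
  cases h with
  | ttt i j h | tut i j h =>
    obtain ⟨ab, c, rfl, hab, hc⟩ := hd.split
    obtain ⟨a, b, rfl, ha, hb⟩ := hab.split
    rcases ha.t_inv with rfl | rfl
    all_goals
      first
      | (rcases hb.t_inv with (rfl | rfl))
      | obtain rfl := hb.u_inv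
    all_goals rcases hc.t_inv with rfl | rfl
    all_goals
      with_reducible first
      | exact Or.inl ⟨_, .uuu i j h⟩
      | exact Or.inl ⟨_, .utu i j h⟩
      | exact Or.inl ⟨_, .tuu i j h⟩
      | exact Or.inl ⟨_, .uut i j h⟩
      | exact Or.inl ⟨_, .utt i j h⟩
      | exact Or.inl ⟨_, .ttu i j h⟩
      | exact Or.inr ⟨_, .ttt i j h, Dom.refl _⟩
      | exact Or.inr ⟨_, .tut i j h, Dom.refl _⟩
      | exact Or.inr ⟨_, .tut i j h, ((Dom.refl _).mul (Dom.tu _)).mul (Dom.refl _)⟩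

theorem BraidRule.symm {N : ℕ} {l r : FreeMonoid (BrauerLetter N)}
    (h : BraidRule N l r) : BraidRule N r l := by
  cases h with
  | ttt i j h => exact .ttt j i h.symm'
  | tut i j h => exact .tut j i h.symm'

theorem SwapRule.symm {N : ℕ} {l r : FreeMonoid (BrauerLetter N)}
    (h : SwapRule N l r) : SwapRule N r l := by
  cases h with
  | tt i j h => exact .tt j i (Or.symm h)
  | tu i j h => exact .ut j i (Or.symm h)
  | ut i j h => exact .tu j i (Or.symm h)
  | uu i j h => exact .uu j i (Or.symm h)

theorem dom_swap {N : ℕ} {l r l' : FreeMonoid (BrauerLetter N)}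
    (h : SwapRule N l r) (hd : Dom l' l) : ∃ r', SwapRule N l' r' ∧ Dom r' r := by
  cases h with
  | tt i j h | tu i j h | ut i j h | uu i j h =>
    obtain ⟨a, b, rfl, ha, hb⟩ := hd.split
    first
    | (rcases ha.t_inv with (rfl | rfl))
    | obtain rfl := ha.u_inv
    all_goals
      first
      | (rcases hb.t_inv with (rfl | rfl))
      | obtain rfl := hb.u_inv
    all_goals exact ⟨_, by constructor; exact h, hb.mul ha⟩

theorem BraidRule.length_eq {N : ℕ} {l r : FreeMonoid (BrauerLetter N)}
    (h : BraidRule N l r) : r.length = l.length := by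
  cases h <;> simp [Tgen, Ugen]

theorem SwapRule.length_eq {N : ℕ} {l r : FreeMonoid (BrauerLetter N)}
    (h : SwapRule N l r) : r.length = l.length := by
  cases h <;> simp [Tgen, Ugen]

/-- Minimality of a word. -/
def IsMinWord {N : ℕ} (w : FreeMonoid (BrauerLetter N)) : Prop :=
  ∀ v : FreeMonoid (BrauerLetter N), brauerCon N w v → w.length ≤ v.length

theorem brauerCon_context {N : ℕ} {l r : FreeMonoid (BrauerLetter N)} (h : brauerRel N l r)
    (p q : FreeMonoid (BrauerLetter N)) : brauerCon N (p * l * q) (p * r * q) :=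
  (brauerCon N).mul ((brauerCon N).mul ((brauerCon N).refl p) (ConGen.Rel.of _ _ h))
    ((brauerCon N).refl q)

theorem IsMinWord.no_delete {N : ℕ} {p l q r : FreeMonoid (BrauerLetter N)}
    (hm : IsMinWord (p * l * q)) (h : DeleteRule N l r) : False := by
  have h1 := hm _ (brauerCon_context (Or.inl h) p q)
  have h2 := h.length_lt
  simp only [FreeMonoid.length_mul] at h1
  omega

theorem IsMinWord.congr {N : ℕ} {x y : FreeMonoid (BrauerLetter N)}
    (hm : IsMinWord x) (h : brauerCon N x y) (hl : y.length = x.length) : IsMinWord y :=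
  fun v hv => hl ▸ hm v ((brauerCon N).trans h hv)

/-- The invariant is preserved by rewrite steps. -/
theorem dom_step {N : ℕ} {x y y' : FreeMonoid (BrauerLetter N)}
    (hm : IsMinWord x) (hd : Dom x y) (hs : BrauerStep N y y') :
    ∃ x', IsMinWord x' ∧ Dom x' y' ∧ x'.length = x.length := by
  obtain ⟨p, q, l, r, hr, rfl, rfl⟩ := hs
  obtain ⟨pl', q', rfl, hpl, hq⟩ := hd.split
  obtain ⟨p', l', rfl, hp, hl⟩ := hpl.split
  have finish : ∀ r', brauerRel N l' r' → r'.length = l'.length → Dom r' r →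
      ∃ x', IsMinWord x' ∧ Dom x' (p * r * q) ∧ x'.length = (p' * l' * q').length := by
    intro r' h1 h2 h3
    have h4 : (p' * r' * q').length = (p' * l' * q').length := by
      simp only [FreeMonoid.length_mul, h2]
    exact ⟨p' * r' * q', hm.congr (brauerCon_context h1 _ _) h4, (hp.mul h3).mul hq, h4⟩
  have braid : BraidRule N l r →
      ∃ x', IsMinWord x' ∧ Dom x' (p * r * q) ∧ x'.length = (p' * l' * q').length := fun h => by
    rcases dom_braid h hl with ⟨r', h'⟩ | ⟨r', h', h''⟩
    · exact (hm.no_delete h').elim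
    · exact finish r' (Or.inr (Or.inl h')) h'.length_eq h''
  have swap : SwapRule N l r →
      ∃ x', IsMinWord x' ∧ Dom x' (p * r * q) ∧ x'.length = (p' * l' * q').length := fun h => by
    obtain ⟨r', h', h''⟩ := dom_swap h hl
    exact finish r' (Or.inr (Or.inr h')) h'.length_eq h''
  rcases hr with h | h | h | h | h
  · obtain ⟨r', h'⟩ := dom_delete h hl
    exact (hm.no_delete h').elim
  · exact braid h
  · exact braid h.symm
  · exact swap h
  · exact swap h.symm

theorem dom_steps {N : ℕ} {x y y' : FreeMonoid (BrauerLetter N)}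
    (hm : IsMinWord x) (hd : Dom x y) (hs : Relation.ReflTransGen (BrauerStep N) y y') :
    ∃ x', IsMinWord x' ∧ Dom x' y' ∧ x'.length = x.length := by
  induction hs with
  | refl => exact ⟨x, hm, hd, rfl⟩
  | tail _ h ih =>
    obtain ⟨x', h1, h2, h3⟩ := ih
    obtain ⟨x'', h4, h5, h6⟩ := dom_step h1 h2 h
    exact ⟨x'', h4, h5, h6.trans h3⟩

/-- Assume every word can be transformed, by a finite sequence of one-step rewrites,
into a minimal word with the same image in `B_N`.  Then, if `w₁ * w₂ * w₃` is minimal,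
so is the word `w₁ * τ(w₂) * w₃` obtained by applying `τ` only to the subword `w₂`. -/
theorem tauStar_of_minimal_is_minimal (N : ℕ)
    (hass : ∀ w : FreeMonoid (BrauerLetter N),
      ∃ w' : FreeMonoid (BrauerLetter N),
        Relation.ReflTransGen (BrauerStep N) w w' ∧ brauerCon N w w' ∧
        ∀ v : FreeMonoid (BrauerLetter N), brauerCon N w' v → w'.length ≤ v.length)
    (w₁ w₂ w₃ : FreeMonoid (BrauerLetter N))
    (hmin : ∀ v : FreeMonoid (BrauerLetter N),
      brauerCon N (w₁ * w₂ * w₃) v → (w₁ * w₂ * w₃).length ≤ v.length) :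
    ∀ v : FreeMonoid (BrauerLetter N),
      brauerCon N (w₁ * tauWord w₂ * w₃) v →
        (w₁ * tauWord w₂ * w₃).length ≤ v.length := by
  intro v hv
  obtain ⟨w', hs, hc, hw'⟩ := hass (w₁ * tauWord w₂ * w₃)
  have hd : Dom (w₁ * w₂ * w₃) (w₁ * tauWord w₂ * w₃) :=
    ((Dom.refl w₁).mul (Dom.tau w₂)).mul (Dom.refl w₃)
  obtain ⟨x', _, h2, h3⟩ := dom_steps hmin hd hs
  have h4 := hw' v ((brauerCon N).trans ((brauerCon N).symm hc) hv)
  rw [← hd.length_eq, ← h3, h2.length_eq]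
  exact h4
end

section
/- For every element X of the Brauer monoid B_N, the minimal length of a word over {t_1,…,t_{N−1}, u_1,…,u_{N−1}} representing X is at most N(N−1)/2; moreover there exists an element of B_N whose minimal word length is exactly N(N−1)/2. In other words, the longest minimal factorization in B_N has length N(N−1)/2. -/
namespace BrauerAux

/-- The letter of kind `b` (`true` for `t`, `false` for `u`) at a valid index. -/
def letter {N : ℕ} (b : Bool) (i : Fin (N - 1)) : BrauerLetter N :=
  if b then BrauerLetter.t i else BrauerLetter.u i

/-- The image of the letter in the monoid, junk value `1` for invalid indices. -/
def g (N : ℕ) (b : Bool) (i : ℕ) : (brauerCon N).Quotient :=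
  if h : i < N - 1 then (brauerCon N).mk' (FreeMonoid.of (letter b ⟨i, h⟩)) else 1

theorem rel_eq {N : ℕ} {x y : FreeMonoid (BrauerLetter N)} (h : brauerRel N x y) :
    (brauerCon N).mk' x = (brauerCon N).mk' y :=
  (Con.eq _).2 (ConGen.Rel.of _ _ h)

theorem g_t {N i : ℕ} (h : i < N - 1) : g N true i = (brauerCon N).mk' (Tgen ⟨i, h⟩) := by
  simp [g, h, letter, Tgen]

theorem g_u {N i : ℕ} (h : i < N - 1) : g N false i = (brauerCon N).mk' (Ugen ⟨i, h⟩) := by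
  simp [g, h, letter, Ugen]

theorem g_comm {N i j : ℕ} (b c : Bool) (hi : i < N - 1) (hj : j < N - 1) (hij : i + 1 < j) :
    g N b i * g N c j = g N c j * g N b i := by
  have hf : BrauerFar (⟨i, hi⟩ : Fin (N - 1)) ⟨j, hj⟩ := Or.inl hij
  cases b <;> cases c <;> simp only [g_t hi, g_t hj, g_u hi, g_u hj, ← map_mul] <;> apply rel_eq
  · exact Or.inr (Or.inr (SwapRule.uu _ _ hf))
  · exact Or.inr (Or.inr (SwapRule.ut _ _ hf))
  · exact Or.inr (Or.inr (SwapRule.tu _ _ hf))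
  · exact Or.inr (Or.inr (SwapRule.tt _ _ hf))

theorem g_same {N i : ℕ} (b c : Bool) (hi : i < N - 1) :
    g N b i * g N c i = 1 ∨ g N b i * g N c i = g N false i := by
  cases b <;> cases c <;> simp only [g_t hi, g_u hi, ← map_mul]
  · exact Or.inr (rel_eq (Or.inl (DeleteRule.uu _)))
  · exact Or.inr (rel_eq (Or.inl (DeleteRule.ut _)))
  · exact Or.inr (rel_eq (Or.inl (DeleteRule.tu _)))
  · exact Or.inl ((rel_eq (Or.inl (DeleteRule.tt _))).trans (map_one _))

/-- Reducing a product of three letters at indices `n+1, n, n+1`. -/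
theorem g_three {N n : ℕ} (a b c : Bool) (hn : n + 1 < N - 1) :
    (∃ e, g N a (n+1) * g N b n * g N c (n+1) = g N e (n+1)) ∨
    (∃ e f, g N a (n+1) * g N b n * g N c (n+1) = g N e (n+1) * g N f n) ∨
    (∃ e f, g N a (n+1) * g N b n * g N c (n+1) = g N e n * g N f (n+1)) ∨
    (∃ e f k, g N a (n+1) * g N b n * g N c (n+1) = g N e n * g N f (n+1) * g N k n) := by
  have hn' : n < N - 1 := by omega
  have ha : BrauerAdj (⟨n+1, hn⟩ : Fin (N - 1)) ⟨n, hn'⟩ := Or.inr rfl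
  cases a <;> cases b <;> cases c
  · refine Or.inl ⟨false, ?_⟩
    simp only [g_t hn, g_u hn, g_t hn', g_u hn', ← map_mul]
    exact rel_eq (Or.inl (DeleteRule.uuu _ _ ha))
  · refine Or.inr (Or.inl ⟨false, true, ?_⟩)
    simp only [g_t hn, g_u hn, g_t hn', g_u hn', ← map_mul]
    exact rel_eq (Or.inl (DeleteRule.uut _ _ ha))
  · refine Or.inl ⟨false, ?_⟩
    simp only [g_t hn, g_u hn, g_t hn', g_u hn', ← map_mul]
    exact rel_eq (Or.inl (DeleteRule.utu _ _ ha))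
  · refine Or.inr (Or.inl ⟨false, false, ?_⟩)
    simp only [g_t hn, g_u hn, g_t hn', g_u hn', ← map_mul]
    exact rel_eq (Or.inl (DeleteRule.utt _ _ ha))
  · refine Or.inr (Or.inr (Or.inl ⟨true, false, ?_⟩))
    simp only [g_t hn, g_u hn, g_t hn', g_u hn', ← map_mul]
    exact rel_eq (Or.inl (DeleteRule.tuu _ _ ha))
  · refine Or.inr (Or.inr (Or.inr ⟨true, false, true, ?_⟩))
    simp only [g_t hn, g_u hn, g_t hn', g_u hn', ← map_mul]
    exact rel_eq (Or.inr (Or.inl (BraidRule.tut _ _ ha)))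
  · refine Or.inr (Or.inr (Or.inl ⟨false, false, ?_⟩))
    simp only [g_t hn, g_u hn, g_t hn', g_u hn', ← map_mul]
    exact rel_eq (Or.inl (DeleteRule.ttu _ _ ha))
  · refine Or.inr (Or.inr (Or.inr ⟨true, true, true, ?_⟩))
    simp only [g_t hn, g_u hn, g_t hn', g_u hn', ← map_mul]
    exact rel_eq (Or.inr (Or.inl (BraidRule.ttt _ _ ha)))

/-- Descending products `g_{n-1} g_{n-2} ⋯ g_k`. -/
def D (N : ℕ) : ℕ → Set (brauerCon N).Quotient
  | 0 => {1}
  | n + 1 => {x | x = 1 ∨ ∃ b, ∃ d ∈ D N n, x = g N b n * d}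

theorem one_mem_D (N n : ℕ) : (1 : (brauerCon N).Quotient) ∈ D N n := by
  cases n
  · exact rfl
  · exact Or.inl rfl

/-- The submonoid generated by letters with index below `n`. -/
def H (N n : ℕ) : Submonoid (brauerCon N).Quotient :=
  Submonoid.closure {x | ∃ b, ∃ i < n, x = g N b i}

theorem g_mem_H {N n i : ℕ} (b : Bool) (h : i < n) : g N b i ∈ H N n :=
  Submonoid.subset_closure ⟨b, i, h, rfl⟩

theorem H_mono {N m n : ℕ} (h : m ≤ n) : H N m ≤ H N n := by
  apply Submonoid.closure_mono
  rintro x ⟨b, i, hi, rfl⟩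
  exact ⟨b, i, by omega, rfl⟩

theorem D_sub_H {N n : ℕ} : ∀ x ∈ D N n, x ∈ H N n := by
  induction n with
  | zero => intro x hx; obtain rfl : x = 1 := hx; exact one_mem _
  | succ n ih =>
    rintro x (rfl | ⟨b, d, hd, rfl⟩)
    · exact one_mem _
    · exact mul_mem (g_mem_H b (by omega)) (H_mono (Nat.le_succ n) (ih d hd))

theorem H_comm {N n : ℕ} (c : Bool) (hn : n + 1 < N - 1 + 1) (x : (brauerCon N).Quotient)
    (hx : x ∈ H N (n - 1)) : x * g N c n = g N c n * x := by
  induction hx using Submonoid.closure_induction with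
  | mem x hx =>
    obtain ⟨b, i, hi, rfl⟩ := hx
    exact g_comm b c (by omega) (by omega) (by omega)
  | one => simp
  | mul x y _ _ hx hy => rw [mul_assoc, hy, ← mul_assoc, hx, mul_assoc]

theorem D_mul {N n : ℕ} (hn : n ≤ N - 1) : ∀ d ∈ D N n, ∀ c, ∀ i < n,
    ∃ h ∈ H N (n - 1), ∃ d' ∈ D N n, d * g N c i = h * d' := by
  induction n with
  | zero => intro d _ c i hi; omega
  | succ n ih =>
    rintro d (rfl | ⟨b, d, hd, rfl⟩) c i hi
    · rcases Nat.lt_succ_iff_lt_or_eq.1 hi with h | rfl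
      · exact ⟨_, g_mem_H c h, 1, one_mem_D _ _, by simp⟩
      · exact ⟨1, one_mem _, g N c i, Or.inr ⟨c, 1, one_mem_D _ _, by simp⟩, by simp⟩
    · rcases Nat.lt_succ_iff_lt_or_eq.1 hi with h | rfl
      · obtain ⟨x, hx, d', hd', e⟩ := ih (by omega) d hd c i h
        refine ⟨x, H_mono (by omega) hx, g N b n * d', Or.inr ⟨b, d', hd', rfl⟩, ?_⟩
        rw [mul_assoc, e, ← mul_assoc, ← H_comm b (by omega) x hx, mul_assoc]
      · -- now `i = n`
        have base : ∃ h ∈ H N i, ∃ d' ∈ D N (i+1), g N b i * g N c i = h * d' := by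
          rcases g_same b c (show i < N - 1 by omega) with e | e
          · exact ⟨1, one_mem _, 1, one_mem_D _ _, by simp [e]⟩
          · exact ⟨1, one_mem _, g N false i, Or.inr ⟨false, 1, one_mem_D _ _, by simp⟩, by simp [e]⟩
        cases i with
        | zero =>
          obtain rfl : d = 1 := hd
          simpa using base
        | succ n =>
          rcases hd with rfl | ⟨a, d, hd, rfl⟩
          · simpa using base
          · have hH : d ∈ H N n := D_sub_H d hd
            have hH' : d ∈ H N (n + 1) := H_mono (by omega) hH
            have hc : ∀ e, d * g N e (n+1) = g N e (n+1) * d := fun e =>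
              H_comm e (by omega) d hH
            have key : g N b (n+1) * (g N a n * d) * g N c (n+1)
                = (g N b (n+1) * g N a n * g N c (n+1)) * d := by
              simp only [mul_assoc, hc]
            have one : ∀ e, g N e (n+1) ∈ D N (n+1+1) := fun e =>
              Or.inr ⟨e, 1, one_mem_D _ _, by simp⟩
            have two : ∀ e f, g N e (n+1) * (g N f n * d) ∈ D N (n+1+1) := fun e f =>
              Or.inr ⟨e, _, Or.inr ⟨f, d, hd, rfl⟩, rfl⟩
            have hg : ∀ e, g N e n ∈ H N (n+1) := fun e => g_mem_H e (by omega)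
            rw [key]
            rcases g_three b a c (show n + 1 < N - 1 by omega) with
              ⟨e, h⟩ | ⟨e, f, h⟩ | ⟨e, f, h⟩ | ⟨e, f, k, h⟩
            · exact ⟨d, hH', _, one e, by rw [h, hc]⟩
            · exact ⟨1, one_mem _, _, two e f, by rw [h, one_mul, mul_assoc]⟩
            · exact ⟨g N e n * d, mul_mem (hg e) hH', _, one f, by rw [h, mul_assoc, mul_assoc, hc]⟩
            · exact ⟨g N e n, hg e, _, two f k, by rw [h]; simp only [mul_assoc]⟩

theorem H_decomp {N n : ℕ} (hn : n + 1 ≤ N - 1) (x : (brauerCon N).Quotient)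
    (hx : x ∈ H N (n + 1)) : ∃ h ∈ H N n, ∃ d ∈ D N (n + 1), x = h * d := by
  induction hx using Submonoid.closure_induction_right with
  | one => exact ⟨1, one_mem _, 1, one_mem_D _ _, by simp⟩
  | mul_right x hx y hy ih =>
    obtain ⟨c, i, hi, rfl⟩ := hy
    obtain ⟨h, hh, d, hd, rfl⟩ := ih
    obtain ⟨h', hh', d', hd', e⟩ := D_mul hn d hd c i hi
    exact ⟨h * h', mul_mem hh hh', d', hd', by rw [mul_assoc, e, mul_assoc]⟩

/-- `x` has a representing word of length at most `k`. -/
def Short {N : ℕ} (x : (brauerCon N).Quotient) (k : ℕ) : Prop :=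
  ∃ w : FreeMonoid (BrauerLetter N), (brauerCon N).mk' w = x ∧ w.length ≤ k

theorem short_one {N : ℕ} (k : ℕ) : Short (1 : (brauerCon N).Quotient) k :=
  ⟨1, map_one _, by simp⟩

theorem Short.mul {N k l : ℕ} {x y : (brauerCon N).Quotient} (hx : Short x k) (hy : Short y l) :
    Short (x * y) (k + l) := by
  obtain ⟨w, rfl, hw⟩ := hx
  obtain ⟨v, rfl, hv⟩ := hy
  exact ⟨w * v, map_mul _ _ _, by rw [FreeMonoid.length_mul]; omega⟩

theorem short_g (N : ℕ) (b : Bool) (i : ℕ) : Short (g N b i) 1 := by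
  by_cases h : i < N - 1
  · exact ⟨FreeMonoid.of (letter b ⟨i, h⟩), by simp [g, h], by simp⟩
  · simpa [g, h] using short_one 1

theorem short_D {N n : ℕ} : ∀ d ∈ D N n, Short d n := by
  induction n with
  | zero => intro x hx; obtain rfl : x = 1 := hx; exact short_one _
  | succ n ih =>
    rintro x (rfl | ⟨b, d, hd, rfl⟩)
    · exact short_one _
    · rw [add_comm]
      exact (short_g N b n).mul (ih d hd)

theorem short_H {N n : ℕ} (hn : n ≤ N - 1) : ∀ x ∈ H N n, Short x (∑ i ∈ Finset.range (n+1), i) := by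
  induction n with
  | zero =>
    intro x hx
    have : H N 0 = ⊥ := by simp [H]
    rw [this, Submonoid.mem_bot] at hx
    subst hx
    exact short_one _
  | succ n ih =>
    intro x hx
    obtain ⟨h, hh, d, hd, rfl⟩ := H_decomp hn x hx
    rw [Finset.sum_range_succ]
    exact (ih (by omega) h hh).mul (short_D d hd)

theorem mem_H {N : ℕ} (w : FreeMonoid (BrauerLetter N)) : (brauerCon N).mk' w ∈ H N (N - 1) := by
  induction w using FreeMonoid.inductionOn' with
  | one => rw [map_one]; exact one_mem _
  | of_mul x w ih =>
    rw [map_mul]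
    refine mul_mem ?_ ih
    cases x with
    | t i => rw [show (brauerCon N).mk' (FreeMonoid.of (BrauerLetter.t i)) = g N true i from
              (g_t i.2).symm]; exact g_mem_H _ i.2
    | u i => rw [show (brauerCon N).mk' (FreeMonoid.of (BrauerLetter.u i)) = g N false i from
              (g_u i.2).symm]; exact g_mem_H _ i.2

/-! The lower bound. -/

/-- Adjacent transposition. -/
def s (i : ℕ) : Equiv.Perm ℕ := Equiv.swap i (i + 1)

/-- Letters act as adjacent transpositions or zero. -/
def val {N : ℕ} : BrauerLetter N → WithZero (Equiv.Perm ℕ)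
  | .t i => ((s i : Equiv.Perm ℕ) : WithZero (Equiv.Perm ℕ))
  | .u _ => 0

/-- The monoid homomorphism from words. -/
def F (N : ℕ) : FreeMonoid (BrauerLetter N) →* WithZero (Equiv.Perm ℕ) := FreeMonoid.lift val

theorem F_T {N : ℕ} (i : Fin (N - 1)) : F N (Tgen i) = (s i : Equiv.Perm ℕ) := by
  simp [F, Tgen, val]

theorem F_U {N : ℕ} (i : Fin (N - 1)) : F N (Ugen i) = 0 := by
  simp [F, Ugen, val]

theorem s_mul_self (i : ℕ) : s i * s i = 1 := Equiv.swap_mul_self _ _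

theorem s_far {i j : ℕ} (h : i + 1 < j) : s i * s j = s j * s i := by
  ext x
  simp only [s, Equiv.Perm.mul_apply, Equiv.swap_apply_def]
  grind

theorem s_braid (i : ℕ) : s i * s (i+1) * s i = s (i+1) * s i * s (i+1) := by
  ext x
  simp only [s, Equiv.Perm.mul_apply, Equiv.swap_apply_def]
  grind

theorem F_rel {N : ℕ} {x y : FreeMonoid (BrauerLetter N)} (h : brauerRel N x y) :
    F N x = F N y := by
  rcases h with h | h | h
  · cases h <;> simp only [map_mul, map_one, F_T, F_U, zero_mul, mul_zero]
    rw [← WithZero.coe_mul, s_mul_self, WithZero.coe_one]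
  · cases h with
    | ttt i j h =>
      simp only [map_mul, F_T, ← WithZero.coe_mul]
      rcases h with h | h
      · rw [← h, s_braid]
      · rw [← h, s_braid]
    | tut i j h => simp only [map_mul, F_T, F_U, zero_mul, mul_zero]
  · cases h <;> simp only [map_mul, F_T, F_U, zero_mul, mul_zero]
    rename_i i j h
    rw [← WithZero.coe_mul, ← WithZero.coe_mul]
    rcases h with h | h
    · rw [s_far h]
    · rw [s_far h]

theorem F_con {N : ℕ} {x y : FreeMonoid (BrauerLetter N)}
    (h : (brauerCon N).mk' x = (brauerCon N).mk' y) : F N x = F N y := by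
  have h1 : brauerCon N x y := (Con.eq _).1 h
  have h2 : brauerCon N ≤ Con.ker (F N) := Con.conGen_le.2 fun x y h => F_rel h
  exact h2 h1

/-- Inversions among the first `N` points. -/
def inv (N : ℕ) (σ : Equiv.Perm ℕ) : Finset (ℕ × ℕ) :=
  (Finset.range N ×ˢ Finset.range N).filter fun p => p.1 < p.2 ∧ σ p.2 < σ p.1

theorem mem_inv {N a b : ℕ} {σ : Equiv.Perm ℕ} :
    (a, b) ∈ inv N σ ↔ (a < N ∧ b < N) ∧ a < b ∧ σ b < σ a := by
  unfold inv
  rw [Finset.mem_filter, Finset.mem_product, Finset.mem_range, Finset.mem_range]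

theorem inv_s (N i : ℕ) (σ : Equiv.Perm ℕ) : (inv N (s i * σ)).card ≤ (inv N σ).card + 1 := by
  refine le_trans (Finset.card_le_card ?_)
    (Finset.card_insert_le (σ.symm i, σ.symm (i+1)) (inv N σ))
  rintro ⟨a, b⟩ h
  simp only [mem_inv, Finset.mem_insert,
    Equiv.Perm.mul_apply, Prod.mk.injEq, Equiv.eq_symm_apply] at h ⊢
  obtain ⟨h1, h2, h3⟩ := h
  have : σ a ≠ σ b := fun e => by have := σ.injective e; omega
  simp only [s, Equiv.swap_apply_def] at h3
  grind

theorem inv_le {N : ℕ} (w : FreeMonoid (BrauerLetter N)) :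
    ∀ σ : Equiv.Perm ℕ, F N w = σ → (inv N σ).card ≤ w.length := by
  induction w using FreeMonoid.inductionOn' with
  | one =>
    intro σ h
    rw [map_one, ← WithZero.coe_one, WithZero.coe_inj] at h
    subst h
    have : inv N 1 = ∅ := by
      ext ⟨a, b⟩
      simp only [mem_inv, Equiv.Perm.one_apply, Finset.notMem_empty, iff_false]
      omega
    simp [this]
  | of_mul x w ih =>
    intro σ h
    rw [map_mul] at h
    rw [FreeMonoid.length_mul, FreeMonoid.length_of]
    cases x with
    | u i =>
      rw [show F N (FreeMonoid.of (BrauerLetter.u i)) = 0 from F_U i, zero_mul] at h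
      exact absurd h.symm WithZero.coe_ne_zero
    | t i =>
      rw [show F N (FreeMonoid.of (BrauerLetter.t i)) = _ from F_T i] at h
      cases hw : F N w with
      | zero =>
        rw [hw, mul_zero] at h
        exact absurd h.symm WithZero.coe_ne_zero
      | coe τ =>
        rw [hw, ← WithZero.coe_mul, WithZero.coe_inj] at h
        subst h
        have := ih τ hw
        have := inv_s N i τ
        omega

/-- The word `t_{n-1} ⋯ t_0`. -/
theorem exists_cycle {N n : ℕ} (hn : n ≤ N - 1) : ∃ (w : FreeMonoid (BrauerLetter N))
    (σ : Equiv.Perm ℕ), F N w = σ ∧ w.length = n ∧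
      ∀ x, σ x = if x = 0 then n else if x ≤ n then x - 1 else x := by
  induction n with
  | zero => exact ⟨1, 1, by simp, by simp, fun x => by simp only [Equiv.Perm.one_apply]; grind⟩
  | succ n ih =>
    obtain ⟨w, σ, h1, h2, h3⟩ := ih (by omega)
    refine ⟨Tgen ⟨n, by omega⟩ * w, s n * σ, ?_, ?_, fun x => ?_⟩
    · rw [map_mul, F_T, h1, WithZero.coe_mul]
    · rw [FreeMonoid.length_mul, h2, Tgen, FreeMonoid.length_of, add_comm]
    · rw [Equiv.Perm.mul_apply, h3, s, Equiv.swap_apply_def]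
      grind

theorem exists_rev {N n : ℕ} (hn : n ≤ N - 1) : ∃ (w : FreeMonoid (BrauerLetter N))
    (σ : Equiv.Perm ℕ), F N w = σ ∧ w.length = ∑ i ∈ Finset.range (n+1), i ∧
      ∀ x, σ x = if x ≤ n then n - x else x := by
  induction n with
  | zero => exact ⟨1, 1, by simp, by simp, fun x => by simp only [Equiv.Perm.one_apply]; grind⟩
  | succ n ih =>
    obtain ⟨w, σ, h1, h2, h3⟩ := ih (by omega)
    obtain ⟨v, τ, h4, h5, h6⟩ := exists_cycle hn
    refine ⟨w * v, σ * τ, ?_, ?_, fun x => ?_⟩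
    · rw [map_mul, h4, h1, WithZero.coe_mul]
    · rw [FreeMonoid.length_mul, h2, h5, Finset.sum_range_succ _ (n+1)]
    · rw [Equiv.Perm.mul_apply, h6, h3]
      grind

theorem card_inv_rev {N : ℕ} (σ : Equiv.Perm ℕ)
    (h : ∀ x, σ x = if x ≤ N - 1 then N - 1 - x else x) :
    (inv N σ).card = ∑ i ∈ Finset.range N, i := by
  have : inv N σ = ((Finset.range N).sigma fun i => Finset.range i).map
      ⟨fun p => (p.2, p.1), by rintro ⟨a, b⟩ ⟨c, d⟩ h; simp at h; simp [h]⟩ := by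
    ext ⟨a, b⟩
    simp only [mem_inv, Finset.mem_range, h, Finset.mem_map,
      Finset.mem_sigma, Function.Embedding.coeFn_mk, Prod.mk.injEq, Sigma.exists]
    constructor
    · rintro ⟨h1, h2, h3⟩
      exact ⟨b, a, ⟨h1.2, h2⟩, rfl⟩
    · rintro ⟨b', a', ⟨h1, h2⟩, e⟩
      obtain ⟨rfl, rfl⟩ := Prod.mk.inj e
      grind
  rw [this, Finset.card_map, Finset.card_sigma]
  simp

end BrauerAux

/-- Every element of the Brauer monoid `B_N` is represented by a word of length at most
`N (N - 1) / 2`, and there is an element of `B_N` whose minimal representing word length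
is exactly `N (N - 1) / 2`: the longest minimal factorization in `B_N` has length
`N (N - 1) / 2`. -/
theorem longest_minimal_factorization (N : ℕ) (hN : 1 ≤ N) :
    (∀ X : (brauerCon N).Quotient, ∃ w : FreeMonoid (BrauerLetter N),
        (brauerCon N).mk' w = X ∧ w.length ≤ N * (N - 1) / 2) ∧
    ∃ X : (brauerCon N).Quotient,
      (∀ w : FreeMonoid (BrauerLetter N),
        (brauerCon N).mk' w = X → N * (N - 1) / 2 ≤ w.length) ∧
      ∃ w : FreeMonoid (BrauerLetter N),
        (brauerCon N).mk' w = X ∧ w.length = N * (N - 1) / 2 := by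
  have hs : ∑ i ∈ Finset.range (N - 1 + 1), i = N * (N - 1) / 2 := by
    rw [Nat.sub_add_cancel hN, Finset.sum_range_id]
  refine ⟨fun X => ?_, ?_⟩
  · obtain ⟨w, rfl⟩ := Con.mk'_surjective X
    rw [← hs]
    exact BrauerAux.short_H le_rfl _ (BrauerAux.mem_H w)
  · obtain ⟨w, σ, h1, h2, h3⟩ := BrauerAux.exists_rev (N := N) (n := N - 1) le_rfl
    refine ⟨(brauerCon N).mk' w, fun v hv => ?_, w, rfl, h2.trans hs⟩
    have := BrauerAux.inv_le v σ ((BrauerAux.F_con hv).trans h1)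
    rwa [BrauerAux.card_inv_rev σ h3, Finset.sum_range_id] at this
end

section
/- Let σ be a permutation of {1,…,N} and let x₁ be such that σ(x₁) > x₁ (a negative transversal edge). If the crossing number of the edge at x₁ strictly exceeds its size, i.e. card{ j : (j < x₁ and σ(j) > σ(x₁)) or (j > x₁ and σ(j) < σ(x₁)) } > σ(x₁) − x₁ (the edge comes back), then there exists x₂ < x₁ with σ(x₂) > σ(x₁). -/
/-- The crossing number of the edge at position `x` of the tangle of the permutation `σ`:
the number of positions `j` with (`j < x` and `σ j > σ x`) or (`j > x` and `σ j < σ x`). -/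
def crossingNumber {N : ℕ} (σ : Equiv.Perm (Fin N)) (x : Fin N) : ℕ :=
  (Finset.univ.filter fun j : Fin N => (j < x ∧ σ x < σ j) ∨ (x < j ∧ σ j < σ x)).card

/-- If the crossing number of a negative transversal edge `(x₁, σ x₁)` strictly exceeds
its size `σ x₁ - x₁` (the edge comes back), then there exists another edge `(x₂, σ x₂)`
with `x₂ < x₁` and `σ x₂ > σ x₁`. -/
theorem exists_edge_of_comesBack {N : ℕ} (σ : Equiv.Perm (Fin N)) (x₁ : Fin N)
    (hneg : x₁ < σ x₁) (hcross : (σ x₁ : ℕ) - (x₁ : ℕ) < crossingNumber σ x₁) :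
    ∃ x₂ : Fin N, x₂ < x₁ ∧ σ x₁ < σ x₂ := by
  by_contra! hcon
  unfold crossingNumber at hcross
  set C := Finset.univ.filter fun j : Fin N =>
    (j < x₁ ∧ σ x₁ < σ j) ∨ (x₁ < j ∧ σ j < σ x₁) with hC
  have hdisj : Disjoint (Finset.Iio x₁) C := by
    rw [Finset.disjoint_left]
    intro j hj hjC
    simp only [Finset.mem_Iio] at hj
    simp only [hC, Finset.mem_filter, Finset.mem_univ, true_and] at hjC
    rcases hjC with ⟨_, h⟩ | ⟨h, _⟩
    · exact absurd h (not_lt.mpr (hcon j hj))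
    · exact absurd h (not_lt.mpr hj.le)
  have hle : (Finset.Iio x₁ ∪ C).card ≤ (Finset.Iio (σ x₁)).card := by
    refine Finset.card_le_card_of_injOn σ ?_ σ.injective.injOn
    intro j hj
    simp only [hC, Finset.coe_union, Set.mem_union, Finset.mem_coe, Finset.mem_Iio,
      Finset.mem_filter, Finset.mem_univ, true_and] at hj ⊢
    rcases hj with h | ⟨h, h2⟩ | ⟨_, h⟩
    · exact lt_of_le_of_ne (hcon j h) fun e => h.ne (σ.injective e)
    · exact absurd h2 (not_lt.mpr (hcon j h))
    · exact h
  rw [Finset.card_union_of_disjoint hdisj, Fin.card_Iio, Fin.card_Iio] at hle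
  omega
end

section
/- (LZR decomposition) Let 1 ≤ x < y ≤ N and let σ be a permutation of {1,…,N} with σ(x) = y, and suppose there is no x₂ < x with σ(x₂) > y (equivalently, the edge (x, y') does not come back). Then there exist permutations L and R of {1,…,N} such that L fixes every point ≤ x, R fixes every point ≥ y, σ = R ∘ Z_{x,y} ∘ L (apply L first, then Z_{x,y}, then R), and inv(σ) = inv(L) + (y − x) + inv(R). Moreover, in the special case y = N, L can be taken to be the identity permutation. -/
/-- The number of inversions of a permutation `σ` of `Fin N`. -/
def inversions {N : ℕ} (σ : Equiv.Perm (Fin N)) : ℕ :=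
  (Finset.univ.filter fun p : Fin N × Fin N => p.1 < p.2 ∧ σ p.2 < σ p.1).card

/-- `IsLZR σ L Z R x y` says that `σ = R ∘ Z ∘ L` (apply `L` first) is an LZR
decomposition of `σ` relative to the edge `(x, y)`:
`Z` is the permutation `Z_{x,y}` sending `x ↦ y`, `k ↦ k - 1` for `x < k ≤ y`, and
fixing all other points (it corresponds to `T_x ∘ T_{x+1} ∘ ⋯ ∘ T_{y-1}` and has
exactly `y - x` inversions); `L` fixes every point `≤ x`; `R` fixes every point `≥ y`;
and `inv σ = inv L + (y - x) + inv R`. -/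
def IsLZR {N : ℕ} (σ L Z R : Equiv.Perm (Fin N)) (x y : Fin N) : Prop :=
  (Z x = y ∧ (∀ k : Fin N, x < k → k ≤ y → (Z k : ℕ) + 1 = (k : ℕ)) ∧
    (∀ k : Fin N, k ≠ x → ¬(x < k ∧ k ≤ y) → Z k = k)) ∧
  (∀ k : Fin N, k ≤ x → L k = k) ∧
  (∀ k : Fin N, y ≤ k → R k = k) ∧
  σ = R * Z * L ∧
  inversions σ = inversions L + ((y : ℕ) - (x : ℕ)) + inversions R

theorem inversions_mul_swap {N : ℕ} (σ : Equiv.Perm (Fin N)) (i j : Fin N)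
    (hij : (j : ℕ) = i + 1) (h : σ i < σ j) :
    inversions (σ * Equiv.swap i j) = inversions σ + 1 := by
  unfold inversions
  have hne : i ≠ j := by rintro rfl; omega
  have key : ∀ a b : Fin N, a < b → (a, b) ≠ (i, j) →
      Equiv.swap i j a < Equiv.swap i j b := by
    intro a b hab hp
    have hp' : ¬ (a = i ∧ b = j) := by simpa using hp
    simp only [Equiv.swap_apply_def]
    clear hp h
    rw [Fin.lt_def] at hab ⊢
    simp only [Fin.ext_iff] at hne hp' ⊢
    split_ifs <;> omega
  have himg : (Finset.univ.filter fun p : Fin N × Fin N =>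
        p.1 < p.2 ∧ (σ * Equiv.swap i j) p.2 < (σ * Equiv.swap i j) p.1)
      = insert (i, j) ((Finset.univ.filter fun p : Fin N × Fin N =>
        p.1 < p.2 ∧ σ p.2 < σ p.1).image
          (fun p => (Equiv.swap i j p.1, Equiv.swap i j p.2))) := by
    ext ⟨a, b⟩
    simp only [Finset.mem_filter, Finset.mem_univ, true_and, Finset.mem_insert,
      Finset.mem_image]
    simp only [Equiv.Perm.mul_apply]
    constructor
    · rintro ⟨hab, hs⟩
      by_cases hp : (a, b) = (i, j)
      · exact Or.inl hp
      · exact Or.inr ⟨(Equiv.swap i j a, Equiv.swap i j b), ⟨key a b hab hp, hs⟩, by simp⟩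
    · rintro (hp | ⟨⟨c, d⟩, ⟨hcd, hs⟩, he⟩)
      · simp only [Prod.mk.injEq] at hp
        obtain ⟨rfl, rfl⟩ := hp
        refine ⟨by rw [Fin.lt_def]; omega, by simpa using h⟩
      · simp only [Prod.mk.injEq] at he
        obtain ⟨rfl, rfl⟩ := he
        refine ⟨key c d hcd ?_, by simpa using hs⟩
        intro hp
        simp only [Prod.mk.injEq] at hp
        obtain ⟨rfl, rfl⟩ := hp
        exact absurd hs (not_lt.2 h.le)
  rw [himg, Finset.card_insert_of_notMem, Finset.card_image_of_injective]
  · rintro ⟨a, b⟩ ⟨c, d⟩ he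
    simpa using he
  · simp only [Finset.mem_image, Finset.mem_filter, Finset.mem_univ, true_and, not_exists]
    rintro ⟨c, d⟩ ⟨⟨hcd, hs⟩, he⟩
    simp only [Prod.mk.injEq] at he
    obtain ⟨h1, h2⟩ := he
    have hc : c = j := by
      rw [← Equiv.swap_apply_left i j] at h1; simpa using congrArg (Equiv.swap i j) h1
    have hd : d = i := by
      simpa using congrArg (Equiv.swap i j) h2
    have hcd' : (c : ℕ) < d := hcd
    rw [hc, hd] at hcd'
    omega

theorem inversions_one {N : ℕ} : inversions (1 : Equiv.Perm (Fin N)) = 0 := by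
  unfold inversions
  rw [Finset.card_eq_zero, Finset.filter_eq_empty_iff]
  rintro p - ⟨h1, h2⟩
  exact absurd h1 (not_lt.2 (le_of_lt h2))

theorem zr_aux {N : ℕ} (y : Fin N) : ∀ (d : ℕ) (σ : Equiv.Perm (Fin N)) (x : Fin N),
    (x : ℕ) + d = y → σ x = y → (∀ k, y < k → σ k = k) →
    ∃ Z R : Equiv.Perm (Fin N), IsLZR σ 1 Z R x y := by
  intro d
  induction d with
  | zero =>
    intro σ x hd hσ hf
    have hx : x = y := Fin.ext (by omega)
    subst hx
    refine ⟨1, σ, ⟨rfl, ?_, fun _ _ _ => rfl⟩, fun _ _ => rfl, ?_, by simp, ?_⟩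
    · intro k h1 h2
      exact absurd h1 (not_lt.2 h2)
    · intro k hk
      rcases hk.eq_or_lt with rfl | hk
      · exact hσ
      · exact hf k hk
    · rw [inversions_one]; omega
  | succ d ih =>
    intro σ x hd hσ hf
    have hyN := y.isLt
    obtain ⟨x', hx'⟩ : ∃ x' : Fin N, (x' : ℕ) = x + 1 := ⟨⟨x + 1, by omega⟩, rfl⟩
    have hne : x' ≠ x := by rintro rfl; omega
    have hlt : σ x' < y := by
      rcases lt_trichotomy (σ x') y with h | h | h
      · exact h
      · exact absurd (σ.injective (h.trans hσ.symm)) hne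
      · have h2 := σ.injective (hf _ h)
        rw [h2, Fin.lt_def] at h
        omega
    have hback : σ = σ * Equiv.swap x x' * Equiv.swap x x' := by
      rw [mul_assoc, Equiv.swap_mul_self, mul_one]
    have hinv := inversions_mul_swap (σ * Equiv.swap x x') x x' hx' (by simpa [hσ] using hlt)
    rw [← hback] at hinv
    obtain ⟨Z, R, ⟨hZ1, hZ2, hZ3⟩, -, hR, hmul, hin⟩ :=
      ih (σ * Equiv.swap x x') x' (by omega) (by simpa using hσ) (by
        intro k hk
        have h1 : k ≠ x := by rintro rfl; rw [Fin.lt_def] at hk; omega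
        have h2 : k ≠ x' := by rintro rfl; rw [Fin.lt_def] at hk; omega
        rw [Equiv.Perm.mul_apply, Equiv.swap_apply_of_ne_of_ne h1 h2, hf k hk])
    refine ⟨Z * Equiv.swap x x', R, ⟨by simpa using hZ1, ?_, ?_⟩, fun _ _ => rfl, hR, ?_, ?_⟩
    · intro k h1 h2
      rw [Equiv.Perm.mul_apply]
      by_cases hk : k = x'
      · rw [hk, Equiv.swap_apply_right, hZ3 x hne.symm (by rw [Fin.lt_def]; omega), hx']
      · rw [Equiv.swap_apply_of_ne_of_ne h1.ne' hk]
        refine hZ2 k ?_ h2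
        rw [Fin.lt_def] at *
        rw [Fin.ext_iff] at hk
        omega
    · intro k h1 h2
      have hk : k ≠ x' := by
        rintro rfl
        exact h2 ⟨by rw [Fin.lt_def]; omega, by rw [Fin.le_def]; omega⟩
      rw [Equiv.Perm.mul_apply, Equiv.swap_apply_of_ne_of_ne h1 hk]
      refine hZ3 k hk ?_
      rintro ⟨h3, h4⟩
      exact h2 ⟨by rw [Fin.lt_def] at *; omega, h4⟩
    · rw [mul_one] at *
      rw [← mul_assoc, ← hmul]
      exact hback
    · rw [inversions_one] at *
      omega

theorem lzr_step {N : ℕ} (x y : Fin N) (hxy : x < y) (σ : Equiv.Perm (Fin N))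
    (hσ : σ x = y) (hnb : ¬ ∃ x₂ : Fin N, x₂ < x ∧ y < σ x₂)
    (ih : ∀ σ' : Equiv.Perm (Fin N), inversions σ = inversions σ' + 1 → σ' x = y →
      (¬ ∃ x₂ : Fin N, x₂ < x ∧ y < σ' x₂) →
      ∃ L Z R : Equiv.Perm (Fin N), IsLZR σ' L Z R x y) :
    ∃ L Z R : Equiv.Perm (Fin N), IsLZR σ L Z R x y := by
  by_cases hex : ∃ i j : Fin N, (j : ℕ) = i + 1 ∧ x < i ∧ y < σ i ∧ σ j < σ i
  · obtain ⟨i, j, hij, hxi, hyi, hji⟩ := hex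
    have hxj : x < j := by rw [Fin.lt_def] at *; omega
    have hne : i ≠ j := by rintro rfl; omega
    have hback : σ = σ * Equiv.swap i j * Equiv.swap i j := by
      rw [mul_assoc, Equiv.swap_mul_self, mul_one]
    have hinv := inversions_mul_swap (σ * Equiv.swap i j) i j hij (by simpa using hji)
    rw [← hback] at hinv
    have hfix : ∀ k, k ≤ x → Equiv.swap i j k = k := fun k hk =>
      Equiv.swap_apply_of_ne_of_ne (hk.trans_lt hxi).ne (hk.trans_lt hxj).ne
    obtain ⟨L, Z, R, ⟨hZ1, hZ2, hZ3⟩, hL, hR, hmul, hin⟩ := ih (σ * Equiv.swap i j) hinv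
      (by rw [Equiv.Perm.mul_apply, hfix x le_rfl, hσ])
      (by
        rintro ⟨k, hk, hk2⟩
        rw [Equiv.Perm.mul_apply, hfix k hk.le] at hk2
        exact hnb ⟨k, hk, hk2⟩)
    have hRZ : ∀ k, y < k → R (Z k) = k := by
      intro k hk
      rw [hZ3 k (hxy.trans hk).ne' (fun h => absurd h.2 (not_le.2 hk)), hR k hk.le]
    have happ : ∀ k, R (Z (L k)) = σ (Equiv.swap i j k) := fun k => by
      have := congrArg (fun f : Equiv.Perm (Fin N) => f k) hmul
      simpa using this.symm
    have hLv : ∀ k, y < σ (Equiv.swap i j k) → L k = σ (Equiv.swap i j k) := by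
      intro k hk
      apply Z.injective
      apply R.injective
      rw [happ, hRZ _ hk]
    have hLj : L j = σ i := by
      have := hLv j (by simpa using hyi)
      simpa using this
    have hLij : L i < L j := by
      rw [hLj]
      by_cases h : y < L i
      · have h1 := happ i
        rw [hRZ _ h, Equiv.swap_apply_left] at h1
        rw [h1]
        exact hji
      · exact (not_lt.1 h).trans_lt hyi
    have hinvL := inversions_mul_swap L i j hij hLij
    refine ⟨L * Equiv.swap i j, Z, R, ⟨hZ1, hZ2, hZ3⟩, ?_, hR, ?_, by omega⟩
    · intro k hk
      rw [Equiv.Perm.mul_apply, hfix k hk, hL k hk]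
    · rw [← mul_assoc, ← hmul]
      exact hback
  · have hf : ∀ (m : ℕ) (k : Fin N), (k : ℕ) + m = N → y < k → σ k = k := by
      intro m
      induction m using Nat.strong_induction_on with
      | _ m ihm =>
        intro k hkm hyk
        have hbig : ∀ l : Fin N, k < l → σ l = l := fun l hl =>
          ihm (N - l) (by rw [Fin.lt_def] at hl; omega) l (by omega) (hyk.trans hl)
        obtain ⟨i, hi⟩ := σ.surjective k
        rcases lt_trichotomy i k with h | h | h
        · exfalso
          have hxi : x < i := by
            rcases lt_trichotomy x i with h' | h' | h'
            · exact h'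
            · rw [← h', hσ] at hi
              exact absurd hi hyk.ne
            · exact absurd ⟨i, h', hi ▸ hyk⟩ hnb
          obtain ⟨j, hj⟩ : ∃ j : Fin N, (j : ℕ) = i + 1 :=
            ⟨⟨i + 1, by rw [Fin.lt_def] at h; omega⟩, rfl⟩
          have hjk : k < σ j := by
            by_contra hc
            rcases (not_lt.1 hc).eq_or_lt with hc | hc
            · have := σ.injective (hc.trans hi.symm)
              rw [this] at hj
              omega
            · exact hex ⟨i, j, hj, hxi, hi ▸ hyk, hi.symm ▸ hc⟩
          have h3 := σ.injective (hbig _ hjk)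
          rw [h3, Fin.lt_def] at hjk
          rw [Fin.lt_def] at h
          omega
        · rwa [h] at hi
        · have := hbig i h
          rw [hi] at this
          exact absurd this h.ne
    obtain ⟨Z, R, h⟩ := zr_aux y (y - x) σ x (by rw [Fin.lt_def] at hxy; omega) hσ
      (fun k hk => hf (N - k) k (by omega) hk)
    exact ⟨1, Z, R, h⟩

theorem lzr_aux {N : ℕ} (x y : Fin N) (hxy : x < y) : ∀ (n : ℕ) (σ : Equiv.Perm (Fin N)),
    inversions σ = n → σ x = y → (¬ ∃ x₂ : Fin N, x₂ < x ∧ y < σ x₂) →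
    ∃ L Z R : Equiv.Perm (Fin N), IsLZR σ L Z R x y := by
  intro n
  induction n with
  | zero =>
    intro σ hn hσ hnb
    exact lzr_step x y hxy σ hσ hnb (fun σ' h => by omega)
  | succ n ih =>
    intro σ hn hσ hnb
    exact lzr_step x y hxy σ hσ hnb (fun σ' h => ih σ' (by omega))

/-- LZR decomposition: if `σ x = y` with `x < y` and there is no `x₂ < x` with
`σ x₂ > y` (the edge `(x, y)` does not come back), then `σ` admits an LZR
decomposition `σ = R ∘ Z_{x,y} ∘ L`; moreover if `y` is the last node then `L` can be
taken to be the identity. -/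
theorem lzr_decomposition {N : ℕ} (σ : Equiv.Perm (Fin N)) (x y : Fin N) (hxy : x < y)
    (hσ : σ x = y) (hnb : ¬ ∃ x₂ : Fin N, x₂ < x ∧ y < σ x₂) :
    (∃ L Z R : Equiv.Perm (Fin N), IsLZR σ L Z R x y) ∧
    ((y : ℕ) + 1 = N → ∃ Z R : Equiv.Perm (Fin N), IsLZR σ 1 Z R x y) := by
  refine ⟨lzr_aux x y hxy _ σ rfl hσ hnb, fun hN => ?_⟩
  refine zr_aux y (y - x) σ x (by rw [Fin.lt_def] at hxy; omega) hσ ?_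
  intro k hk
  rw [Fin.lt_def] at hk
  omega
end

section
/- Let K be a type and let c, d : {1,…,N} → K be colorings of the upper and lower nodes such that for every k ∈ K the fibers c⁻¹(k) and d⁻¹(k) have the same cardinality. Call a permutation σ of {1,…,N} color-matching if d(σ(x)) = c(x) for all x. If σ is color-matching and minimizes the number of inversions among all color-matching permutations, then no two edges of the same color cross: for all x < y with c(x) = c(y), σ(x) < σ(y). -/
/-- Swapping the endpoints of two crossing edges strictly decreases the number of crossings. -/
theorem inversions_swap_lt {N : ℕ} (σ : Equiv.Perm (Fin N)) (x y : Fin N) (hxy : x < y)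
    (h : σ y < σ x) : inversions (σ * Equiv.swap x y) < inversions σ := by
  unfold inversions
  set s := Equiv.swap x y with hs
  have hss : ∀ a, s (s a) = a := fun a => Equiv.swap_apply_self x y a
  have hsx : s x = y := Equiv.swap_apply_left x y
  have hsy : s y = x := Equiv.swap_apply_right x y
  have hso : ∀ a, a ≠ x → a ≠ y → s a = a := fun a h1 h2 => Equiv.swap_apply_of_ne_of_ne h1 h2
  clear_value s
  have hmem : (x, y) ∈ Finset.univ.filter
      fun p : Fin N × Fin N => p.1 < p.2 ∧ σ p.2 < σ p.1 := by simp [hxy, h]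
  refine lt_of_le_of_lt ?_ (Finset.card_erase_lt_of_mem hmem)
  apply Finset.card_le_card_of_injOn
    (fun p => if s p.1 < s p.2 then (s p.1, s p.2) else p)
  · rintro ⟨a, b⟩ hp
    replace hp := (Finset.mem_filter.mp (Finset.mem_coe.mp hp)).2
    simp only [Equiv.Perm.mul_apply] at hp
    obtain ⟨hab, hinv⟩ := hp
    simp only [Finset.mem_coe, Finset.mem_erase, Finset.mem_filter, Finset.mem_univ, true_and]
    split_ifs with hlt
    · refine ⟨?_, hlt, hinv⟩
      intro he
      obtain ⟨h1, h2⟩ := Prod.mk.inj he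
      have := hss a
      have := hss b
      rw [h1] at *
      rw [h2] at *
      grind
    · have hax : a = x ∨ a ≠ x := em _
      have hay : a = y ∨ a ≠ y := em _
      have hbx : b = x ∨ b ≠ x := em _
      have hby : b = y ∨ b ≠ y := em _
      refine ⟨?_, hab, ?_⟩
      · intro he
        obtain ⟨h1, h2⟩ := Prod.mk.inj he
        subst h1 h2
        rw [hsx, hsy] at hinv
        exact absurd hinv (not_lt.mpr h.le)
      · grind
  · rintro ⟨a, b⟩ hp ⟨a2, b2⟩ hp2 he
    simp only [Finset.mem_coe, Finset.mem_filter, Finset.mem_univ, true_and] at hp hp2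
    have h1 := hss a
    have h2 := hss b
    have h3 := hss a2
    have h4 := hss b2
    simp only at he
    split_ifs at he <;> grind

/-- Let `c`, `d` be colorings of the upper and lower nodes with equal-sized fibers.
If `σ` is color-matching (`d (σ x) = c x` for all `x`) and minimizes the number of
inversions among all color-matching permutations, then no two edges of the same color
cross: `x < y` and `c x = c y` imply `σ x < σ y`. -/
theorem sameColor_edges_do_not_cross {N : ℕ} {K : Type*} [DecidableEq K]
    (c d : Fin N → K)
    (hfib : ∀ k : K, (Finset.univ.filter fun x : Fin N => c x = k).card =
      (Finset.univ.filter fun x : Fin N => d x = k).card)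
    (σ : Equiv.Perm (Fin N)) (hσ : ∀ x : Fin N, d (σ x) = c x)
    (hmin : ∀ π : Equiv.Perm (Fin N), (∀ x : Fin N, d (π x) = c x) →
      inversions σ ≤ inversions π) :
    ∀ x y : Fin N, x < y → c x = c y → σ x < σ y := by
  intro x y hxy hc
  by_contra hn
  have hlt : σ y < σ x :=
    lt_of_le_of_ne (not_lt.mp hn) fun e => hxy.ne' (σ.injective e)
  refine absurd (hmin (σ * Equiv.swap x y) ?_) (not_le.mpr (inversions_swap_lt σ x y hxy hlt))
  intro z
  rw [Equiv.Perm.mul_apply, hσ]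
  by_cases h1 : z = x
  · subst h1; rw [Equiv.swap_apply_left, hc]
  · by_cases h2 : z = y
    · subst h2; rw [Equiv.swap_apply_right, hc]
    · rw [Equiv.swap_apply_of_ne_of_ne h1 h2]
end

section
/- Let σ be a permutation of {1,…,N} and let x₁ be such that σ(x₁) > x₁. If there exists x₂ < x₁ with σ(x₂) > σ(x₁), then card{ j : j > x₁ and σ(j) < σ(x₁) } ≥ σ(x₁) − x₁ + 1; that is, at least (σ(x₁) − x₁) + 1 edges cross the edge at x₁ from right to left. -/
/-- If `(x₁, σ x₁)` is a negative transversal edge (`σ x₁ > x₁`) and there is another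
edge `(x₂, σ x₂)` with `x₂ < x₁` and `σ x₂ > σ x₁`, then at least `(σ x₁ - x₁) + 1`
edges cross the edge at `x₁` from right to left. -/
theorem edges_crossing_right_to_left {N : ℕ} (σ : Equiv.Perm (Fin N)) (x₁ : Fin N)
    (hneg : x₁ < σ x₁) (x₂ : Fin N) (hx₂ : x₂ < x₁) (hσ : σ x₁ < σ x₂) :
    (σ x₁ : ℕ) - (x₁ : ℕ) + 1 ≤
      (Finset.univ.filter fun j : Fin N => x₁ < j ∧ σ j < σ x₁).card := by
  have hA : ((Finset.Iio (σ x₁)).map σ.symm.toEmbedding).card = (σ x₁ : ℕ) := by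
    rw [Finset.card_map, Fin.card_Iio]
  have hsub : (Finset.Iio (σ x₁)).map σ.symm.toEmbedding ⊆
      (Finset.univ.filter fun j : Fin N => x₁ < j ∧ σ j < σ x₁) ∪
        (Finset.Iio x₁).erase x₂ := by
    intro j hj
    obtain ⟨y, hy, rfl⟩ := Finset.mem_map.1 hj
    have hy' : σ (σ.symm y) < σ x₁ := by simpa using hy
    change σ.symm y ∈ _
    generalize σ.symm y = j at hy'
    simp only [Finset.mem_union, Finset.mem_filter, Finset.mem_univ, true_and,
      Finset.mem_erase, Finset.mem_Iio]
    rcases lt_trichotomy j x₁ with h | h | h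
    · refine Or.inr ⟨?_, h⟩
      rintro rfl
      exact lt_asymm hy' hσ
    · subst h
      exact absurd hy' (lt_irrefl _)
    · exact Or.inl ⟨h, hy'⟩
  have h1 := (Finset.card_le_card hsub).trans (Finset.card_union_le _ _)
  rw [hA, Finset.card_erase_of_mem (Finset.mem_Iio.2 hx₂), Fin.card_Iio] at h1
  have h2 : (x₂ : ℕ) < x₁ := hx₂
  have h3 : (x₁ : ℕ) < σ x₁ := hneg
  omega
end

section
/- Let i, k, j be indices with i < k < j ≤ N − 1, and let s_m denote the adjacent transposition of m and m+1 in {1,…,N}. Let π be the permutation obtained by applying, in order, s_{i+1}, s_{i+2}, …, s_j, then s_k, s_{k+1}, …, s_{j−1}, then s_j. Then inv(π) < (j − i) + (j − k) + 1; that is, the word s_{i+1} ⋯ s_j · s_k ⋯ s_{j−1} · s_j of length (j − i) + (j − k) + 1 is not a minimal factorization of π. -/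
/-- The adjacent transposition `s m` swapping `m` and `m + 1` (nodes are the natural
numbers `1, …, N`; `s m` is used for `1 ≤ m ≤ N - 1`). -/
def adjTransposition (m : ℕ) : Equiv.Perm ℕ :=
  Equiv.swap m (m + 1)

/-- The permutation obtained by applying, in order, the adjacent transpositions of the
word `w = [w₀, w₁, …]` : first `s w₀`, then `s w₁`, and so on. -/
def applyWord (w : List ℕ) : Equiv.Perm ℕ :=
  ((w.map adjTransposition).reverse).prod

theorem applyWord_cons_apply (a : ℕ) (w : List ℕ) (x : ℕ) :
    applyWord (a :: w) x = applyWord w (adjTransposition a x) := by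
  simp [applyWord]

theorem applyWord_append_apply (v w : List ℕ) (x : ℕ) :
    applyWord (v ++ w) x = applyWord w (applyWord v x) := by
  simp [applyWord]

theorem applyWord_range_apply (n a x : ℕ) :
    applyWord (List.range' a n) x =
      if x = a then a + n else if a < x ∧ x ≤ a + n then x - 1 else x := by
  induction n generalizing a x with
  | zero =>
    simp only [List.range'_zero, applyWord, List.map_nil, List.reverse_nil, List.prod_nil,
      Equiv.Perm.coe_one, id]
    split_ifs <;> omega
  | succ n ih =>
    rw [List.range'_succ, applyWord_cons_apply, ih]
    simp only [adjTransposition, Equiv.swap_apply_def]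
    split_ifs <;> omega

/-- For indices `i < k < j ≤ N - 1`, the permutation `π` obtained by applying, in order,
`s_{i+1}, …, s_j`, then `s_k, …, s_{j-1}`, then `s_j`, has strictly fewer than
`(j - i) + (j - k) + 1` inversions; hence the word
`s_{i+1} ⋯ s_j ⬝ s_k ⋯ s_{j-1} ⬝ s_j` of length `(j - i) + (j - k) + 1` is not a minimal
factorization of `π`. -/
theorem not_minimal_word {N i k j : ℕ} (hi : 1 ≤ i) (hik : i < k) (hkj : k < j)
    (hjN : j ≤ N - 1) (π : Equiv.Perm ℕ)
    (hπ : π = applyWord (List.range' (i + 1) (j - i) ++ List.range' k (j - k) ++ [j])) :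
    {p : ℕ × ℕ | p.1 < p.2 ∧ π p.2 < π p.1}.ncard < (j - i) + (j - k) + 1 := by
  have hval : ∀ x, π x = if x = i + 1 then j else if x = k + 1 then j + 1 else
      if i + 1 < x ∧ x ≤ k then x - 1 else if k + 1 < x ∧ x ≤ j + 1 then x - 2 else x := by
    intro x
    have h1 : applyWord [j] = adjTransposition j := by simp [applyWord]
    rw [hπ, applyWord_append_apply, applyWord_append_apply, applyWord_range_apply,
      applyWord_range_apply, h1]
    simp only [adjTransposition, Equiv.swap_apply_def]
    have e1 : i + 1 + (j - i) = j + 1 := by omega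
    have e2 : k + (j - k) = j := by omega
    rw [e1, e2]
    by_cases c1 : x = i + 1
    · subst c1
      simp only [if_true]
      split_ifs <;> omega
    · by_cases c2 : i + 1 < x ∧ x ≤ j + 1
      · rw [if_neg c1, if_neg c1, if_pos c2]
        obtain ⟨c3, c4⟩ := c2
        rcases lt_trichotomy x (k + 1) with c | c | c
        · have d : x - 1 < k := by omega
          split_ifs <;> omega
        · subst c
          simp only [Nat.add_sub_cancel, if_true]
        · split_ifs <;> omega
      · simp only [c1, c2, if_false]
        split_ifs <;> omega
  let S : Finset (ℕ × ℕ) := (Finset.Icc (i + 2) (j + 1)).image (fun y => (i + 1, y)) ∪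
    (Finset.Icc (k + 2) (j + 1)).image (fun y => (k + 1, y))
  have hsub : {p : ℕ × ℕ | p.1 < p.2 ∧ π p.2 < π p.1} ⊆ (S : Set (ℕ × ℕ)) := by
    rintro ⟨x, y⟩ ⟨hxy, hlt⟩
    simp only at hxy hlt
    have key : (x = i + 1 ∧ y ≤ j + 1) ∨ (x = k + 1 ∧ y ≤ j + 1) := by
      rw [hval, hval] at hlt
      split_ifs at hlt <;> omega
    simp only [S, Finset.coe_union, Finset.coe_image, Set.mem_union, Set.mem_image,
      Finset.mem_coe, Finset.mem_Icc, Prod.mk.injEq]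
    rcases key with ⟨h, hb⟩ | ⟨h, hb⟩
    · exact Or.inl ⟨y, by omega, by omega, rfl⟩
    · exact Or.inr ⟨y, by omega, by omega, rfl⟩
  have hle := Set.ncard_le_ncard hsub (Finset.finite_toSet S)
  rw [Set.ncard_coe_finset] at hle
  have hS : S.card ≤ (j - i) + (j - k) := by
    refine (Finset.card_union_le _ _).trans (Nat.add_le_add ?_ ?_)
    · refine Finset.card_image_le.trans ?_
      rw [Nat.card_Icc]; omega
    · refine Finset.card_image_le.trans ?_
      rw [Nat.card_Icc]; omega
  omega
end
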